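/- arXiv:1806.08559 — 3 statements merged into one kernel-verified Lean document; each statement's English description precedes it below -/
import Mathlib

section
/- Let u be a nonconstant solution of -Δu = f(u) in B₁ and suppose that (0,0) is a degenerate critical point of u which is a local maximum point, and that u_xx(0,0) = u_xy(0,0) = 0. Then u_yy(0,0) < 0. -/
open Filter Metric Set

/-- Partial derivative in the first variable. -/
noncomputable def pdx (u : ℝ → ℝ → ℝ) : ℝ → ℝ → ℝ := fun x y => deriv (fun t => u t y) x

/-- Partial derivative in the second variable. -/
noncomputable def pdy (u : ℝ → ℝ → ℝ) : ℝ → ℝ → ℝ := fun x y => deriv (fun t => u x t) y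

/-- `pd u i j = ∂^(i+j) u / ∂x^i ∂y^j`. -/
noncomputable def pd (u : ℝ → ℝ → ℝ) (i j : ℕ) : ℝ → ℝ → ℝ := pdx^[i] (pdy^[j] u)

/-- The open unit ball of `ℝ²`. -/
def B1 : Set (ℝ × ℝ) := Metric.ball (0 : ℝ × ℝ) 1

/-- Real part of `(x+iy)^n`. -/
noncomputable def ReZ (n : ℕ) (x y : ℝ) : ℝ := (((x : ℂ) + (y : ℂ) * Complex.I) ^ n).re

/-- Imaginary part of `(x+iy)^n`. -/
noncomputable def ImZ (n : ℕ) (x y : ℝ) : ℝ := (((x : ℂ) + (y : ℂ) * Complex.I) ^ n).im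
open MeasureTheory

noncomputable def dd (e : ℝ × ℝ) (F : ℝ × ℝ → ℝ) : ℝ × ℝ → ℝ := fun p => fderiv ℝ F p e

noncomputable def lap (F : ℝ × ℝ → ℝ) : ℝ × ℝ → ℝ :=
  fun p => dd (1,0) (dd (1,0) F) p + dd (0,1) (dd (0,1) F) p

abbrev Sm (F : ℝ × ℝ → ℝ) : Prop := ContDiff ℝ (⊤ : ℕ∞) F

lemma dd_contDiffAt {F : ℝ × ℝ → ℝ} {p : ℝ × ℝ} (e : ℝ × ℝ)
    (h : ContDiffAt ℝ (⊤ : ℕ∞) F p) : ContDiffAt ℝ (⊤ : ℕ∞) (dd e F) p := by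
  have h1 : ContDiffAt ℝ (⊤ : ℕ∞) (fderiv ℝ F) p := h.fderiv_right (by simp)
  exact h1.clm_apply contDiffAt_const

lemma dd_sm {F : ℝ × ℝ → ℝ} (e : ℝ × ℝ) (h : Sm F) : Sm (dd e F) := by
  rw [Sm, contDiff_iff_contDiffAt] at *
  exact fun p => dd_contDiffAt e (h p)

lemma ContDiff.da {F : ℝ × ℝ → ℝ} (h : ContDiff ℝ (⊤ : ℕ∞) F) (p : ℝ × ℝ) : DifferentiableAt ℝ F p :=
  (h.differentiable (by simp)) p

lemma dd_mul {F G : ℝ × ℝ → ℝ} (e p : ℝ × ℝ) (hF : DifferentiableAt ℝ F p)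
    (hG : DifferentiableAt ℝ G p) :
    dd e (fun x => F x * G x) p = dd e F p * G p + F p * dd e G p := by
  simp only [dd]
  rw [fderiv_fun_mul hF hG]
  simp; ring

lemma dd_add {F G : ℝ × ℝ → ℝ} (e p : ℝ × ℝ) (hF : DifferentiableAt ℝ F p)
    (hG : DifferentiableAt ℝ G p) :
    dd e (fun x => F x + G x) p = dd e F p + dd e G p := by
  simp only [dd]
  rw [fderiv_fun_add hF hG]
  simp

lemma dd_sub {F G : ℝ × ℝ → ℝ} (e p : ℝ × ℝ) (hF : DifferentiableAt ℝ F p)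
    (hG : DifferentiableAt ℝ G p) :
    dd e (fun x => F x - G x) p = dd e F p - dd e G p := by
  simp only [dd]
  rw [fderiv_fun_sub hF hG]
  simp

lemma dd_const_mul {F : ℝ × ℝ → ℝ} (c : ℝ) (e p : ℝ × ℝ) (hF : DifferentiableAt ℝ F p) :
    dd e (fun x => c * F x) p = c * dd e F p := by
  simp only [dd]
  rw [fderiv_const_mul hF]
  simp

lemma dd_const (c : ℝ) (e p : ℝ × ℝ) : dd e (fun _ => c) p = 0 := by
  simp [dd]

lemma dd_exp {F : ℝ × ℝ → ℝ} (e p : ℝ × ℝ) (hF : DifferentiableAt ℝ F p) :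
    dd e (fun x => Real.exp (F x)) p = Real.exp (F p) * dd e F p := by
  simp only [dd]
  rw [fderiv_exp hF]
  simp

lemma dd_comm {F : ℝ × ℝ → ℝ} (a b p : ℝ × ℝ) (hF : ContDiffAt ℝ (⊤ : ℕ∞) F p) :
    dd a (dd b F) p = dd b (dd a F) p := by
  have h1 : DifferentiableAt ℝ (fderiv ℝ F) p :=
    (hF.fderiv_right (m := (⊤ : ℕ∞)) (by simp)).differentiableAt (by simp)
  have h2 : IsSymmSndFDerivAt ℝ F p := hF.isSymmSndFDerivAt (by
    simp only [minSmoothness_of_isRCLikeNormedField]; exact WithTop.coe_le_coe.2 (le_top (a := (2 : ℕ∞))))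
  have key : ∀ a b : ℝ × ℝ, dd a (dd b F) p = fderiv ℝ (fderiv ℝ F) p a b := by
    intro a b
    have : dd b F = fun x => (fderiv ℝ F x) b := rfl
    rw [this]
    simp only [dd]
    rw [fderiv_clm_apply h1 (by fun_prop)]
    simp
  rw [key, key, h2]

lemma dd_congr {F G : ℝ × ℝ → ℝ} {p : ℝ × ℝ} (e : ℝ × ℝ) (h : F =ᶠ[nhds p] G) :
    dd e F =ᶠ[nhds p] dd e G := by
  filter_upwards [h.fderiv (𝕜 := ℝ)] with x hx
  simp [dd, hx]

lemma lap_congr {F G : ℝ × ℝ → ℝ} {p : ℝ × ℝ} (h : F =ᶠ[nhds p] G) :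
    lap F p = lap G p := by
  simp only [lap]
  rw [(dd_congr _ (dd_congr _ h)).eq_of_nhds, (dd_congr _ (dd_congr _ h)).eq_of_nhds]

lemma lap_sm {F : ℝ × ℝ → ℝ} (h : Sm F) : Sm (lap F) :=
  (dd_sm _ (dd_sm _ h)).add (dd_sm _ (dd_sm _ h))

lemma dd_cs {F : ℝ × ℝ → ℝ} (e : ℝ × ℝ) (h : HasCompactSupport F) :
    HasCompactSupport (dd e F) := h.fderiv_apply ℝ e

lemma lap_cs {F : ℝ × ℝ → ℝ} (h : HasCompactSupport F) :
    HasCompactSupport (lap F) := (dd_cs _ (dd_cs _ h)).add (dd_cs _ (dd_cs _ h))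

lemma int_cs {F : ℝ × ℝ → ℝ} (h : Continuous F) (hc : HasCompactSupport F) : Integrable F :=
  h.integrable_of_hasCompactSupport hc

lemma integral_dd {F : ℝ × ℝ → ℝ} (e : ℝ × ℝ) (h : Sm F) (hc : HasCompactSupport F) :
    ∫ p, dd e F p = 0 := by
  have h1 : Integrable (dd e F) := int_cs (dd_sm e h).continuous (dd_cs e hc)
  have h2 : Integrable F := int_cs h.continuous hc
  have := integral_mul_fderiv_eq_neg_fderiv_mul_of_integrable (μ := (volume : Measure (ℝ × ℝ)))
    (f := fun _ => (1:ℝ)) (g := F) (v := e) (by simp) (by simp only [one_mul]; exact h1)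
    (by simpa using h2) (fun x _ => by fun_prop) (fun x _ => h.da x)
  simp only [one_mul] at this
  exact this.trans (by simp)

lemma carleman2 {v φ : ℝ × ℝ → ℝ} (hv : Sm v) (hφ : Sm φ) (hc : HasCompactSupport v) :
    ∫ p, Real.exp (φ p) * (lap φ p * (v p * v p)) ≤
      ∫ p, Real.exp (φ p) * (dd (1,0) v p * dd (1,0) v p + dd (0,1) v p * dd (0,1) v p) := by
  have hE : Sm (fun p => Real.exp (φ p)) := hφ.exp
  have hx := dd_sm (1,0) hv
  have hy := dd_sm (0,1) hv
  have px := dd_sm (1,0) hφ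
  have py := dd_sm (0,1) hφ
  have pl := lap_sm hφ
  set X : ℝ × ℝ → ℝ := fun p => Real.exp (φ p) * (dd (1,0) φ p * (v p * v p)) with hX
  set Y : ℝ × ℝ → ℝ := fun p => Real.exp (φ p) * (dd (0,1) φ p * (v p * v p)) with hY
  have sX : Sm X := hE.mul (px.mul (hv.mul hv))
  have sY : Sm Y := hE.mul (py.mul (hv.mul hv))
  have cX : HasCompactSupport X := (hc.mul_left.mul_left).mul_left
  have cY : HasCompactSupport Y := (hc.mul_left.mul_left).mul_left
  have iX := integral_dd (1,0) sX cX
  have iY := integral_dd (0,1) sY cY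
  have jX := int_cs (dd_sm (1,0) sX).continuous (dd_cs (1,0) cX)
  have jY := int_cs (dd_sm (0,1) sY).continuous (dd_cs (0,1) cY)
  have i1 : Integrable (fun p => Real.exp (φ p) * (lap φ p * (v p * v p))) :=
    int_cs (hE.mul (pl.mul (hv.mul hv))).continuous (hc.mul_left.mul_left).mul_left
  have i2 : Integrable (fun p => Real.exp (φ p) *
      (dd (1,0) v p * dd (1,0) v p + dd (0,1) v p * dd (0,1) v p)) :=
    int_cs (hE.mul ((hx.mul hx).add (hy.mul hy))).continuous
      (((dd_cs _ hc).mul_left).add ((dd_cs _ hc).mul_left)).mul_left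
  have eX : ∀ p, dd (1,0) X p = Real.exp (φ p) * dd (1,0) φ p * (dd (1,0) φ p * (v p * v p)) +
      Real.exp (φ p) * (dd (1,0) (dd (1,0) φ) p * (v p * v p) +
        dd (1,0) φ p * (2 * v p * dd (1,0) v p)) := by
    intro p
    rw [hX, dd_mul _ _ (hE.da p) ((px.mul (hv.mul hv)).da p), dd_exp _ _ (hφ.da p),
      dd_mul _ _ (px.da p) ((hv.mul hv).da p), dd_mul _ _ (hv.da p) (hv.da p)]
    ring
  have eY : ∀ p, dd (0,1) Y p = Real.exp (φ p) * dd (0,1) φ p * (dd (0,1) φ p * (v p * v p)) +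
      Real.exp (φ p) * (dd (0,1) (dd (0,1) φ) p * (v p * v p) +
        dd (0,1) φ p * (2 * v p * dd (0,1) v p)) := by
    intro p
    rw [hY, dd_mul _ _ (hE.da p) ((py.mul (hv.mul hv)).da p), dd_exp _ _ (hφ.da p),
      dd_mul _ _ (py.da p) ((hv.mul hv).da p), dd_mul _ _ (hv.da p) (hv.da p)]
    ring
  have : ∫ p, (Real.exp (φ p) * (lap φ p * (v p * v p)) - dd (1,0) X p - dd (0,1) Y p) ≤
      ∫ p, Real.exp (φ p) * (dd (1,0) v p * dd (1,0) v p + dd (0,1) v p * dd (0,1) v p) := by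
    refine integral_mono ((i1.sub jX).sub jY) i2 fun p => ?_
    simp only [eX, eY, lap]
    have := mul_nonneg (Real.exp_pos (φ p)).le (add_nonneg
      (mul_self_nonneg (dd (1,0) v p + v p * dd (1,0) φ p))
      (mul_self_nonneg (dd (0,1) v p + v p * dd (0,1) φ p)))
    linarith
  have h3 := integral_sub (i1.sub jX) jY
  have h4 := integral_sub i1 jX
  simp only [Pi.sub_apply] at h3
  rw [h3, h4, iX, iY] at this
  linarith

lemma carleman1_aux {a b φ : ℝ × ℝ → ℝ} (ha : Sm a) (hb : Sm b) (hφ : Sm φ)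
    (ca : HasCompactSupport a) (cb : HasCompactSupport b) (hxyf : dd (0,1) a = dd (1,0) b) :
    ∫ p, Real.exp (φ p) * (lap φ p * (a p * a p + b p * b p)) ≤
      ∫ p, Real.exp (φ p) *
      ((dd (1,0) a p + dd (0,1) b p) * (dd (1,0) a p + dd (0,1) b p)) := by
  have hE : Sm (fun p => Real.exp (φ p)) := hφ.exp
  have px := dd_sm (1,0) hφ
  have py := dd_sm (0,1) hφ
  have pl := lap_sm hφ
  have hxy : ∀ p, dd (0,1) a p = dd (1,0) b p := fun p => by rw [hxyf]
  have axx := dd_sm (1,0) ha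
  have bx := dd_sm (1,0) hb
  have byy := dd_sm (0,1) hb
  set X : ℝ × ℝ → ℝ := fun p => Real.exp (φ p) *
    (2 * (a p * dd (0,1) b p - b p * dd (1,0) b p) - dd (1,0) φ p * (a p * a p + b p * b p)) with hX
  set Y : ℝ × ℝ → ℝ := fun p => Real.exp (φ p) *
    (2 * (b p * dd (1,0) a p - a p * dd (1,0) b p) - dd (0,1) φ p * (a p * a p + b p * b p)) with hY
  have s1 : Sm (fun p => a p * dd (0,1) b p - b p * dd (1,0) b p) := (ha.mul byy).sub (hb.mul bx)
  have s2 : Sm (fun p => b p * dd (1,0) a p - a p * dd (1,0) b p) := (hb.mul axx).sub (ha.mul bx)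
  have s3 : Sm (fun p => a p * a p + b p * b p) := (ha.mul ha).add (hb.mul hb)
  have s1' : Sm (fun p => 2 * (a p * dd (0,1) b p - b p * dd (1,0) b p)) := contDiff_const.mul s1
  have s2' : Sm (fun p => 2 * (b p * dd (1,0) a p - a p * dd (1,0) b p)) := contDiff_const.mul s2
  have s3x : Sm (fun p => dd (1,0) φ p * (a p * a p + b p * b p)) := px.mul s3
  have s3y : Sm (fun p => dd (0,1) φ p * (a p * a p + b p * b p)) := py.mul s3
  have sX : Sm X := hE.mul (s1'.sub s3x)
  have sY : Sm Y := hE.mul (s2'.sub s3y)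
  have c3 : HasCompactSupport (fun p => a p * a p + b p * b p) := ca.mul_left.add cb.mul_left
  have cX : HasCompactSupport X :=
    (((ca.mul_right.sub cb.mul_right).mul_left).sub c3.mul_left).mul_left
  have cY : HasCompactSupport Y :=
    (((cb.mul_right.sub ca.mul_right).mul_left).sub c3.mul_left).mul_left
  have iX := integral_dd (1,0) sX cX
  have iY := integral_dd (0,1) sY cY
  have jX := int_cs (dd_sm (1,0) sX).continuous (dd_cs (1,0) cX)
  have jY := int_cs (dd_sm (0,1) sY).continuous (dd_cs (0,1) cY)
  have i1 : Integrable (fun p => Real.exp (φ p) * (lap φ p * (a p * a p + b p * b p))) :=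
    int_cs (hE.mul (pl.mul s3)).continuous c3.mul_left.mul_left
  have i2 : Integrable (fun p => Real.exp (φ p) *
      ((dd (1,0) a p + dd (0,1) b p) * (dd (1,0) a p + dd (0,1) b p))) :=
    int_cs (hE.mul ((axx.add byy).mul (axx.add byy))).continuous
      ((((dd_cs _ ca).add (dd_cs _ cb)).mul_left).mul_left)
  have hsym : ∀ p, dd (0,1) (dd (1,0) b) p = dd (1,0) (dd (0,1) b) p :=
    fun p => dd_comm _ _ _ hb.contDiffAt
  have hsym2 : ∀ p, dd (0,1) (dd (1,0) a) p = dd (1,0) (dd (1,0) b) p := by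
    intro p; rw [dd_comm _ _ _ ha.contDiffAt, hxyf]
  have eX : ∀ p, dd (1,0) X p = Real.exp (φ p) * dd (1,0) φ p *
      (2 * (a p * dd (0,1) b p - b p * dd (1,0) b p) - dd (1,0) φ p * (a p * a p + b p * b p)) +
      Real.exp (φ p) * (2 * (dd (1,0) a p * dd (0,1) b p + a p * dd (1,0) (dd (0,1) b) p
        - (dd (1,0) b p * dd (1,0) b p + b p * dd (1,0) (dd (1,0) b) p))
        - (dd (1,0) (dd (1,0) φ) p * (a p * a p + b p * b p)
          + dd (1,0) φ p * (2 * a p * dd (1,0) a p + 2 * b p * dd (1,0) b p))) := by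
    intro p
    rw [hX, dd_mul _ _ (hE.da p) ((s1'.sub s3x).da p), dd_exp _ _ (hφ.da p),
      dd_sub _ _ (s1'.da p) (s3x.da p), dd_const_mul _ _ _ (s1.da p),
      dd_sub _ _ ((ha.mul byy).da p) ((hb.mul bx).da p),
      dd_mul _ _ (ha.da p) (byy.da p), dd_mul _ _ (hb.da p) (bx.da p),
      dd_mul _ _ (px.da p) (s3.da p), dd_add _ _ ((ha.mul ha).da p) ((hb.mul hb).da p),
      dd_mul _ _ (ha.da p) (ha.da p), dd_mul _ _ (hb.da p) (hb.da p)]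
    ring
  have eY : ∀ p, dd (0,1) Y p = Real.exp (φ p) * dd (0,1) φ p *
      (2 * (b p * dd (1,0) a p - a p * dd (1,0) b p) - dd (0,1) φ p * (a p * a p + b p * b p)) +
      Real.exp (φ p) * (2 * (dd (0,1) b p * dd (1,0) a p + b p * dd (1,0) (dd (1,0) b) p
        - (dd (1,0) b p * dd (1,0) b p + a p * dd (1,0) (dd (0,1) b) p))
        - (dd (0,1) (dd (0,1) φ) p * (a p * a p + b p * b p)
          + dd (0,1) φ p * (2 * a p * dd (1,0) b p + 2 * b p * dd (0,1) b p))) := by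
    intro p
    rw [hY, dd_mul _ _ (hE.da p) ((s2'.sub s3y).da p), dd_exp _ _ (hφ.da p),
      dd_sub _ _ (s2'.da p) (s3y.da p), dd_const_mul _ _ _ (s2.da p),
      dd_sub _ _ ((hb.mul axx).da p) ((ha.mul bx).da p),
      dd_mul _ _ (hb.da p) (axx.da p), dd_mul _ _ (ha.da p) (bx.da p),
      dd_mul _ _ (py.da p) (s3.da p), dd_add _ _ ((ha.mul ha).da p) ((hb.mul hb).da p),
      dd_mul _ _ (ha.da p) (ha.da p), dd_mul _ _ (hb.da p) (hb.da p), hsym, hsym2, hxy]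
    ring
  have : ∫ p, (Real.exp (φ p) * (lap φ p * (a p * a p + b p * b p)) + dd (1,0) X p + dd (0,1) Y p) ≤
      ∫ p, Real.exp (φ p) *
      ((dd (1,0) a p + dd (0,1) b p) * (dd (1,0) a p + dd (0,1) b p)) := by
    refine integral_mono ((i1.add jX).add jY) i2 fun p => ?_
    simp only [eX, eY, lap]
    have := mul_nonneg (Real.exp_pos (φ p)).le (add_nonneg
      (mul_self_nonneg (dd (1,0) a p - dd (0,1) b p + (dd (1,0) φ p * a p - dd (0,1) φ p * b p)))
      (mul_self_nonneg (2 * dd (1,0) b p + (dd (1,0) φ p * b p + dd (0,1) φ p * a p))))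
    linarith
  have h3 := integral_add (i1.add jX) jY
  have h4 := integral_add i1 jX
  simp only [Pi.add_apply] at h3
  rw [h3, h4, iX, iY] at this
  linarith

lemma carleman1 {v φ : ℝ × ℝ → ℝ} (hv : Sm v) (hφ : Sm φ) (hc : HasCompactSupport v) :
    ∫ p, Real.exp (φ p) *
      (lap φ p * (dd (1,0) v p * dd (1,0) v p + dd (0,1) v p * dd (0,1) v p)) ≤
      ∫ p, Real.exp (φ p) * (lap v p * lap v p) :=
  carleman1_aux (dd_sm (1,0) hv) (dd_sm (0,1) hv) hφ (dd_cs _ hc) (dd_cs _ hc)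
    (funext fun _ => dd_comm _ _ _ hv.contDiffAt)

/-- squared Euclidean distance -/
def sq2 (q p : ℝ × ℝ) : ℝ := (p.1 - q.1) * (p.1 - q.1) + (p.2 - q.2) * (p.2 - q.2)

noncomputable def gw (α : ℝ) (q : ℝ × ℝ) (p : ℝ × ℝ) : ℝ := Real.exp (-α * sq2 q p)

lemma sq2_sm (q : ℝ × ℝ) : Sm (sq2 q) := by unfold sq2 Sm; fun_prop

lemma gw_sm (α : ℝ) (q : ℝ × ℝ) : Sm (gw α q) :=
  (contDiff_const.mul (sq2_sm q)).exp

lemma dd_sq2 (q e p : ℝ × ℝ) :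
    dd e (sq2 q) p = 2 * (p.1 - q.1) * e.1 + 2 * (p.2 - q.2) * e.2 := by
  have h1 : dd e (fun p : ℝ × ℝ => p.1 - q.1) p = e.1 := by
    rw [dd_sub _ _ (by fun_prop) (by fun_prop), dd_const]; simp [dd, fderiv_fst]
  have h2 : dd e (fun p : ℝ × ℝ => p.2 - q.2) p = e.2 := by
    rw [dd_sub _ _ (by fun_prop) (by fun_prop), dd_const]; simp [dd, fderiv_snd]
  unfold sq2
  rw [dd_add _ _ (by fun_prop) (by fun_prop), dd_mul _ _ (by fun_prop) (by fun_prop),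
    dd_mul _ _ (by fun_prop) (by fun_prop), h1, h2]
  ring

lemma dd_gw (α : ℝ) (q e p : ℝ × ℝ) :
    dd e (gw α q) p = gw α q p * (-α * (2 * (p.1 - q.1) * e.1 + 2 * (p.2 - q.2) * e.2)) := by
  have h := (sq2_sm q).da p
  unfold gw
  rw [dd_exp _ _ (by fun_prop), dd_const_mul _ _ _ h, dd_sq2]

lemma dd_dd_gw (α : ℝ) (q e p : ℝ × ℝ) :
    dd e (dd e (gw α q)) p = gw α q p * ((-α * (2 * (p.1 - q.1) * e.1 + 2 * (p.2 - q.2) * e.2)) ^ 2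
      - α * (2 * e.1 * e.1 + 2 * e.2 * e.2)) := by
  have h := (gw_sm α q).da p
  have h1 : dd e (fun p : ℝ × ℝ => p.1 - q.1) p = e.1 := by
    rw [dd_sub _ _ (by fun_prop) (by fun_prop), dd_const]; simp [dd, fderiv_fst]
  have h2 : dd e (fun p : ℝ × ℝ => p.2 - q.2) p = e.2 := by
    rw [dd_sub _ _ (by fun_prop) (by fun_prop), dd_const]; simp [dd, fderiv_snd]
  have h3 : dd e (gw α q) = fun p => gw α q p *
    ((-α * 2 * e.1) * (p.1 - q.1) + (-α * 2 * e.2) * (p.2 - q.2)) := by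
    funext p; rw [dd_gw]; ring
  rw [h3, dd_mul _ _ h (by fun_prop), dd_add _ _ (by fun_prop) (by fun_prop),
    dd_const_mul _ _ _ (by fun_prop), dd_const_mul _ _ _ (by fun_prop), h1, h2, dd_gw]
  ring

lemma lap_gw (α : ℝ) (q p : ℝ × ℝ) :
    lap (gw α q) p = (4 * α ^ 2 * sq2 q p - 4 * α) * gw α q p := by
  simp only [lap, dd_dd_gw, sq2]
  ring

lemma ev_diff {F : ℝ × ℝ → ℝ} {p : ℝ × ℝ} (hF : ContDiffAt ℝ (⊤ : ℕ∞) F p) :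
    ∀ᶠ x in nhds p, DifferentiableAt ℝ F x := by
  filter_upwards [(hF.of_le (m := 1) (by simp)).eventually (by simp)] with x hx
  exact hx.differentiableAt (by simp)

lemma lap_const_mul {F : ℝ × ℝ → ℝ} (c : ℝ) {p : ℝ × ℝ} (hF : ContDiffAt ℝ (⊤ : ℕ∞) F p) :
    lap (fun x => c * F x) p = c * lap F p := by
  have key : ∀ e, dd e (dd e (fun x => c * F x)) p = c * dd e (dd e F) p := by
    intro e
    have h1 : dd e (fun x => c * F x) =ᶠ[nhds p] fun x => c * dd e F x := by
      filter_upwards [ev_diff hF] with x hx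
      exact dd_const_mul _ _ _ hx
    rw [(dd_congr e h1).eq_of_nhds, dd_const_mul _ _ _
      ((dd_contDiffAt e hF).differentiableAt (by simp))]
  simp only [lap, key]; ring

lemma lap_sub {F G : ℝ × ℝ → ℝ} {p : ℝ × ℝ} (hF : ContDiffAt ℝ (⊤ : ℕ∞) F p)
    (hG : ContDiffAt ℝ (⊤ : ℕ∞) G p) :
    lap (fun x => F x - G x) p = lap F p - lap G p := by
  have key : ∀ e, dd e (dd e (fun x => F x - G x)) p = dd e (dd e F) p - dd e (dd e G) p := by
    intro e
    have h1 : dd e (fun x => F x - G x) =ᶠ[nhds p] fun x => dd e F x - dd e G x := by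
      filter_upwards [ev_diff hF, ev_diff hG] with x hx hy
      exact dd_sub _ _ hx hy
    rw [(dd_congr e h1).eq_of_nhds, dd_sub _ _
      ((dd_contDiffAt e hF).differentiableAt (by simp))
      ((dd_contDiffAt e hG).differentiableAt (by simp))]
  simp only [lap, key]; ring

lemma lap_const (c : ℝ) (p : ℝ × ℝ) : lap (fun _ => c) p = 0 := by
  have : ∀ e, dd e (fun _ => c) = fun _ => (0:ℝ) := fun e => funext fun p => dd_const c e p
  simp [lap, this, dd_const]

lemma carleman {v φ : ℝ × ℝ → ℝ} (hv : Sm v) (hφ : Sm φ) (hc : HasCompactSupport v)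
    {m : ℝ} (hm : 0 ≤ m) (h : ∀ p ∈ tsupport v, m ≤ lap φ p) :
    m ^ 2 * ∫ p, Real.exp (φ p) * (v p * v p) ≤ ∫ p, Real.exp (φ p) * (lap v p * lap v p) := by
  have hE : Sm (fun p => Real.exp (φ p)) := hφ.exp
  have hx := dd_sm (1,0) hv
  have hy := dd_sm (0,1) hv
  have pl := lap_sm hφ
  have c1 := dd_cs (1,0) hc
  have c2 := dd_cs (0,1) hc
  have hz : ∀ e, ∀ p ∉ tsupport v, dd e v p = 0 := by
    intro e p hp
    have : v =ᶠ[nhds p] fun _ => 0 := by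
      exact notMem_tsupport_iff_eventuallyEq.1 hp
    rw [(dd_congr e this).eq_of_nhds, dd_const]
  have A : m * ∫ p, Real.exp (φ p) * (v p * v p) ≤
      ∫ p, Real.exp (φ p) * (lap φ p * (v p * v p)) := by
    rw [← integral_const_mul]
    refine integral_mono (int_cs (hE.mul (hv.mul hv)).continuous hc.mul_left.mul_left |>.const_mul m)
      (int_cs (hE.mul (pl.mul (hv.mul hv))).continuous hc.mul_left.mul_left.mul_left) fun p => ?_
    by_cases hp : p ∈ tsupport v
    · have := mul_le_mul_of_nonneg_right (h p hp)
        (mul_nonneg (Real.exp_pos (φ p)).le (mul_self_nonneg (v p)))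
      simp only; linarith
    · simp [image_eq_zero_of_notMem_tsupport hp]
  have B : m * ∫ p, Real.exp (φ p) *
        (dd (1,0) v p * dd (1,0) v p + dd (0,1) v p * dd (0,1) v p) ≤
      ∫ p, Real.exp (φ p) *
        (lap φ p * (dd (1,0) v p * dd (1,0) v p + dd (0,1) v p * dd (0,1) v p)) := by
    rw [← integral_const_mul]
    refine integral_mono (int_cs (hE.mul ((hx.mul hx).add (hy.mul hy))).continuous
      (c1.mul_left.add c2.mul_left).mul_left |>.const_mul m)
      (int_cs (hE.mul (pl.mul ((hx.mul hx).add (hy.mul hy)))).continuous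
        (c1.mul_left.add c2.mul_left).mul_left.mul_left) fun p => ?_
    by_cases hp : p ∈ tsupport v
    · have := mul_le_mul_of_nonneg_right (h p hp)
        (mul_nonneg (Real.exp_pos (φ p)).le (add_nonneg (mul_self_nonneg (dd (1,0) v p))
          (mul_self_nonneg (dd (0,1) v p))))
      simp only; linarith
    · simp [hz _ p hp]
  have C1 := carleman1 hv hφ hc
  have C2 := carleman2 hv hφ hc
  calc m ^ 2 * ∫ p, Real.exp (φ p) * (v p * v p)
      = m * (m * ∫ p, Real.exp (φ p) * (v p * v p)) := by ring
    _ ≤ m * _ := mul_le_mul_of_nonneg_left (A.trans C2) hm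
    _ ≤ _ := B.trans C1

lemma carleman_ucp {v : ℝ × ℝ → ℝ} (hv : Sm v) (hc : HasCompactSupport v) (q : ℝ × ℝ)
    {r C R : ℝ} (hr : 0 < r) (hC0 : 0 ≤ C)
    (h0 : ∀ p, sq2 q p < r → v p = 0)
    (hC : ∀ p, sq2 q p < R → lap v p * lap v p ≤ C * (v p * v p)) :
    ∀ p, sq2 q p < R → v p = 0 := by
  have hsc : Continuous (sq2 q) := (sq2_sm q).continuous
  -- bound on the support
  obtain ⟨S, hS⟩ : ∃ S, ∀ p ∈ tsupport v, sq2 q p ≤ S := by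
    obtain ⟨S, hS⟩ := (IsCompact.image (show IsCompact (tsupport v) from hc) hsc).bddAbove
    exact ⟨S, fun p hp => hS ⟨p, hp, rfl⟩⟩
  have hlow : ∀ p ∈ tsupport v, r ≤ sq2 q p := by
    intro p hp
    have : tsupport v ⊆ {p | r ≤ sq2 q p} := by
      refine closure_minimal ?_ (isClosed_le continuous_const hsc)
      intro p hp
      by_contra hlt
      exact hp (h0 p (not_le.1 hlt))
    exact this hp
  set α := 2 / r with hα
  have hα0 : 0 < α := by positivity
  set κ := 4 * α * Real.exp (-α * S) with hκ
  have hκ0 : 0 < κ := by positivity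
  set A := ∫ p, lap v p * lap v p with hA
  set ψ0 := Real.exp (-α * R) with hψ0
  set g : ℝ × ℝ → ℝ := fun p => min 1 (max 0 (R - sq2 q p)) * (v p * v p) with hg
  have hvv : Integrable (fun p => v p * v p) := int_cs (hv.mul hv).continuous hc.mul_left
  have gc : Continuous g := by
    have := hv.continuous
    rw [hg]; fun_prop
  have gs : HasCompactSupport g := hc.mul_left.mul_left
  have gnn : ∀ p, 0 ≤ g p := fun p => mul_nonneg (le_min zero_le_one (le_max_left _ _))
    (mul_self_nonneg _)
  have hl := lap_sm hv
  have hlc := lap_cs hc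
  have main : ∀ τ : ℝ, 0 ≤ τ → C ≤ (τ * κ) ^ 2 → ((τ * κ) ^ 2 - C) * ∫ p, g p ≤ A := by
    intro τ hτ hCτ
    have hφ : Sm (fun p => τ * gw α q p) := contDiff_const.mul (gw_sm α q)
    have hE : Sm (fun p => Real.exp (τ * gw α q p)) := hφ.exp
    have h1 := carleman hv hφ hc (m := τ * κ) (by positivity) (by
      intro p hp
      rw [lap_const_mul _ (gw_sm α q).contDiffAt, lap_gw]
      refine mul_le_mul_of_nonneg_left ?_ hτ
      have e1 : Real.exp (-α * S) ≤ gw α q p := Real.exp_le_exp.2 (by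
        have := mul_le_mul_of_nonneg_left (hS p hp) hα0.le
        linarith)
      have e2 : 4 * α ≤ 4 * α ^ 2 * sq2 q p - 4 * α := by
        have := mul_le_mul_of_nonneg_left (hlow p hp) hα0.le
        have h3 : α * r = 2 := by rw [hα]; field_simp
        rw [h3] at this
        nlinarith
      exact mul_le_mul e2 e1 (Real.exp_pos _).le (by linarith))
    have i1 : Integrable (fun p => Real.exp (τ * gw α q p) * (v p * v p)) :=
      int_cs (hE.mul (hv.mul hv)).continuous hc.mul_left.mul_left
    have i2 : Integrable (fun p => Real.exp (τ * gw α q p) * (lap v p * lap v p)) :=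
      int_cs (hE.mul (hl.mul hl)).continuous hlc.mul_left.mul_left
    have i3 : Integrable (fun p => lap v p * lap v p) :=
      int_cs (hl.mul hl).continuous hlc.mul_left
    have mono1 : ∀ p, R ≤ sq2 q p → gw α q p ≤ ψ0 := fun p hp => Real.exp_le_exp.2 (by
      have := mul_le_mul_of_nonneg_left hp hα0.le
      linarith)
    have mono2 : ∀ p, sq2 q p ≤ R → ψ0 ≤ gw α q p := fun p hp => Real.exp_le_exp.2 (by
      have := mul_le_mul_of_nonneg_left hp hα0.le
      linarith)
    set e0 := Real.exp (τ * ψ0) with he0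
    have he0p : 0 < e0 := Real.exp_pos _
    have b1 : ∫ p, Real.exp (τ * gw α q p) * (lap v p * lap v p) ≤
        C * (∫ p, Real.exp (τ * gw α q p) * (v p * v p)) + e0 * A := by
      rw [hA, ← integral_const_mul, ← integral_const_mul,
        ← integral_add (i1.const_mul C) (i3.const_mul e0)]
      refine integral_mono i2 ((i1.const_mul C).add (i3.const_mul e0)) fun p => ?_
      have hEp := (Real.exp_pos (τ * gw α q p)).le
      simp only
      rcases lt_or_ge (sq2 q p) R with hp | hp
      · have t1 := mul_le_mul_of_nonneg_left (hC p hp) hEp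
        have t2 := mul_nonneg he0p.le (mul_self_nonneg (lap v p))
        linarith
      · have t1 : Real.exp (τ * gw α q p) ≤ e0 :=
          Real.exp_le_exp.2 (mul_le_mul_of_nonneg_left (mono1 p hp) hτ)
        have t2 := mul_le_mul_of_nonneg_right t1 (mul_self_nonneg (lap v p))
        have t3 := mul_nonneg hC0 (mul_nonneg hEp (mul_self_nonneg (v p)))
        linarith
    have b2 : e0 * ∫ p, g p ≤ ∫ p, Real.exp (τ * gw α q p) * (v p * v p) := by
      rw [← integral_const_mul]
      refine integral_mono ((int_cs gc gs).const_mul e0) i1 fun p => ?_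
      simp only
      rcases lt_or_ge (sq2 q p) R with hp | hp
      · have t1 : e0 ≤ Real.exp (τ * gw α q p) :=
          Real.exp_le_exp.2 (mul_le_mul_of_nonneg_left (mono2 p hp.le) hτ)
        have t2 : g p ≤ v p * v p :=
          mul_le_of_le_one_left (mul_self_nonneg _) (min_le_left _ _)
        exact mul_le_mul t1 t2 (gnn p) (Real.exp_pos _).le
      · have t1 : g p = 0 := by
          have : max 0 (R - sq2 q p) = 0 := max_eq_left (by linarith)
          simp [hg, this]
        rw [t1, mul_zero]
        exact mul_nonneg (Real.exp_pos _).le (mul_self_nonneg _)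
    have b3 := mul_le_mul_of_nonneg_left b2 (sub_nonneg.2 hCτ)
    have b4 : e0 * (((τ * κ) ^ 2 - C) * ∫ p, g p) ≤ e0 * A := by linarith
    exact le_of_mul_le_mul_left b4 he0p
  intro p hp
  by_contra hne
  have hG : 0 < ∫ p, g p := by
    refine gc.integral_pos_of_hasCompactSupport_nonneg_nonzero gs gnn (x := p) ?_
    have : 0 < min 1 (max 0 (R - sq2 q p)) := lt_min one_pos (lt_max_of_lt_right (by linarith))
    exact mul_ne_zero this.ne' (mul_ne_zero hne hne)
  have hA0 : 0 ≤ A := integral_nonneg fun p => mul_self_nonneg _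
  set G := ∫ p, g p with hGdef
  set X := C + A / G + 1 with hX
  have hAG : 0 ≤ A / G := by positivity
  have hX2 : X ≤ X ^ 2 := by nlinarith
  have := main (X / κ) (by positivity) (by rw [div_mul_cancel₀ _ hκ0.ne']; linarith)
  rw [div_mul_cancel₀ _ hκ0.ne'] at this
  have h5 : A / G * G = A := div_mul_cancel₀ _ hG.ne'
  have h6 : (A / G + 1) * G ≤ (X ^ 2 - C) * G :=
    mul_le_mul_of_nonneg_right (by linarith) hG.le
  linarith

lemma ucp_ball {W : ℝ × ℝ → ℝ} {O : Set (ℝ × ℝ)} (hO : IsOpen O)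
    (hW : ContDiffOn ℝ (⊤ : ℕ∞) W O) (q : ℝ × ℝ) {ρ C : ℝ} (hρ : 0 < ρ) (hC0 : 0 ≤ C)
    (hb : closedBall q (2 * ρ) ⊆ O) (h0 : W =ᶠ[nhds q] fun _ => 0)
    (hC : ∀ p ∈ closedBall q (2 * ρ), lap W p * lap W p ≤ C * (W p * W p)) :
    ∀ p, sq2 q p < ρ * ρ → W p = 0 := by
  let χ : ContDiffBump q := ⟨ρ, 2 * ρ, hρ, by linarith⟩
  have hmem : ∀ p, sq2 q p < ρ * ρ → p ∈ ball q ρ := by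
    intro p hp
    unfold sq2 at hp
    have a1 : |p.1 - q.1| < ρ := by
      apply abs_lt_of_sq_lt_sq _ hρ.le
      nlinarith [mul_self_nonneg (p.2 - q.2)]
    have a2 : |p.2 - q.2| < ρ := by
      apply abs_lt_of_sq_lt_sq _ hρ.le
      nlinarith [mul_self_nonneg (p.1 - q.1)]
    rw [mem_ball, Prod.dist_eq, Real.dist_eq, Real.dist_eq]
    exact max_lt a1 a2
  set v : ℝ × ℝ → ℝ := fun p => χ p * W p with hv
  have hvW : ∀ p ∈ ball q ρ, v =ᶠ[nhds p] W := by
    intro p hp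
    filter_upwards [isOpen_ball.mem_nhds hp] with x hx
    have : χ x = 1 := χ.one_of_mem_closedBall (ball_subset_closedBall hx)
    simp [hv, this]
  have hsup : tsupport v ⊆ closedBall q (2 * ρ) := by
    have h1 : tsupport v ⊆ tsupport χ := tsupport_mul_subset_left
    rw [χ.tsupport_eq] at h1
    exact h1
  have hcs : HasCompactSupport v := χ.hasCompactSupport.mul_right
  have hsm : Sm v := by
    rw [Sm, contDiff_iff_contDiffAt]
    intro p
    by_cases hp : p ∈ O
    · exact (χ.contDiff.contDiffAt).mul (hW.contDiffAt (hO.mem_nhds hp))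
    · have hp' : p ∉ tsupport v := fun h => hp (hb (hsup h))
      have : v =ᶠ[nhds p] fun _ => 0 := notMem_tsupport_iff_eventuallyEq.1 hp'
      exact (contDiffAt_const (c := (0:ℝ))).congr_of_eventuallyEq this
  obtain ⟨r, hr, hr0⟩ := Metric.eventually_nhds_iff.1 h0
  have hmem' : ∀ p, sq2 q p < r * r → dist p q < r := by
    intro p hp
    unfold sq2 at hp
    have a1 : |p.1 - q.1| < r := by
      apply abs_lt_of_sq_lt_sq _ hr.le
      nlinarith [mul_self_nonneg (p.2 - q.2)]
    have a2 : |p.2 - q.2| < r := by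
      apply abs_lt_of_sq_lt_sq _ hr.le
      nlinarith [mul_self_nonneg (p.1 - q.1)]
    rw [Prod.dist_eq, Real.dist_eq, Real.dist_eq]
    exact max_lt a1 a2
  have key := carleman_ucp hsm hcs q (r := r * r) (C := C) (R := ρ * ρ) (by positivity) hC0
    (fun p hp => by simp [hv, hr0 (hmem' p hp)])
    (fun p hp => by
      have h1 := hmem p hp
      rw [lap_congr (hvW p h1), (hvW p h1).eq_of_nhds]
      exact hC p (ball_subset_closedBall (ball_subset_ball (by linarith) h1)))
  intro p hp
  rw [← (hvW p (hmem p hp)).eq_of_nhds]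
  exact key p hp

lemma dd_dd_nonneg {g : ℝ × ℝ → ℝ} {p : ℝ × ℝ} (hg : ContDiffAt ℝ (⊤ : ℕ∞) g p)
    (hmin : IsLocalMin g p) (e : ℝ × ℝ) : 0 ≤ dd e (dd e g) p := by
  have hγ : ∀ t : ℝ, HasDerivAt (fun t : ℝ => p + t • e) e t := by
    intro t
    simpa using ((hasDerivAt_id t).smul_const e).const_add p
  have hγ0 : Tendsto (fun t : ℝ => p + t • e) (nhds 0) (nhds p) := by
    have := (hγ 0).continuousAt.tendsto
    simpa using this
  set k : ℝ → ℝ := fun t => g (p + t • e) with hk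
  have hline : ∀ (F : ℝ × ℝ → ℝ) (t : ℝ), DifferentiableAt ℝ F (p + t • e) →
      HasDerivAt (fun t : ℝ => F (p + t • e)) (dd e F (p + t • e)) t :=
    fun F t hF => hF.hasFDerivAt.comp_hasDerivAt t (hγ t)
  have h1 : deriv k =ᶠ[nhds 0] fun t => dd e g (p + t • e) := by
    filter_upwards [hγ0.eventually (ev_diff hg)] with t ht
    exact (hline g t ht).deriv
  have h2 : deriv (deriv k) 0 = dd e (dd e g) p := by
    rw [h1.deriv_eq]
    have := (hline (dd e g) 0 (by simpa using (dd_contDiffAt e hg).differentiableAt (by simp))).deriv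
    rw [this]; simp
  have hkmin : IsLocalMin k 0 := by
    have := hγ0.eventually hmin
    filter_upwards [this] with t ht
    simpa [hk] using ht
  by_contra hneg
  rw [← h2, not_le] at hneg
  have hkc : ContinuousAt k 0 :=
    (hline g 0 (by simpa using hg.differentiableAt (by simp))).continuousAt
  have hmax := isLocalMax_of_deriv_deriv_neg hneg hkmin.deriv_eq_zero hkc
  have hconst : k =ᶠ[nhds 0] fun _ => k 0 := by
    filter_upwards [hkmin, hmax] with t a b
    exact le_antisymm b a
  have h3 : deriv k =ᶠ[nhds 0] fun _ => 0 := by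
    have := hconst.deriv
    simpa using this
  rw [h3.deriv_eq] at hneg
  simp at hneg

lemma lap_nonneg {g : ℝ × ℝ → ℝ} {p : ℝ × ℝ} (hg : ContDiffAt ℝ (⊤ : ℕ∞) g p)
    (hmin : IsLocalMin g p) : 0 ≤ lap g p :=
  add_nonneg (dd_dd_nonneg hg hmin _) (dd_dd_nonneg hg hmin _)

lemma strong_min {h : ℝ × ℝ → ℝ} {r C : ℝ} (hC0 : 0 ≤ C)
    (hh : ContDiffOn ℝ (⊤ : ℕ∞) h (ball 0 r)) (hnn : ∀ p ∈ ball (0 : ℝ × ℝ) r, 0 ≤ h p)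
    (hl : ∀ p ∈ ball (0 : ℝ × ℝ) r, lap h p ≤ C * h p) (h0 : h 0 = 0) :
    ∀ p ∈ ball (0 : ℝ × ℝ) (r / 8), h p = 0 := by
  intro p hp
  by_contra hne
  have hp1 : |p.1| < r / 8 ∧ |p.2| < r / 8 := by
    rw [mem_ball, dist_zero_right, Prod.norm_def] at hp
    exact max_lt_iff.1 hp
  have hrpos : 0 < r := by linarith [abs_nonneg p.1, hp1.1]
  have hpr : p ∈ ball (0 : ℝ × ℝ) r := ball_subset_ball (by linarith) hp
  have hpp : 0 < h p := lt_of_le_of_ne (hnn p hpr) (Ne.symm hne)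
  set s0 := sq2 p 0 with hs0
  have hs0' : s0 = p.1 * p.1 + p.2 * p.2 := by simp [hs0, sq2]
  have hs0pos : 0 < s0 := by
    have hpne : p ≠ 0 := fun h => hne (h ▸ h0)
    rw [hs0']
    by_contra hcon
    apply hpne
    ext
    · simp only [Prod.fst_zero]; nlinarith [mul_self_nonneg p.1, mul_self_nonneg p.2]
    · simp only [Prod.snd_zero]; nlinarith [mul_self_nonneg p.1, mul_self_nonneg p.2]
  have hsc : Continuous (sq2 p) := (sq2_sm p).continuous
  -- h is bounded below near p
  have hca : ContinuousAt h p := (hh.contDiffAt (isOpen_ball.mem_nhds hpr)).continuousAt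
  obtain ⟨δ, hδ, hδh⟩ := Metric.eventually_nhds_iff.1 (hca.eventually (lt_mem_nhds (half_lt_self hpp)))
  set d := min (δ * δ / 2) (s0 / 2) with hd
  have hdpos : 0 < d := lt_min (by positivity) (by positivity)
  have hdd : ∀ x, sq2 p x ≤ d → h p / 2 < h x := by
    intro x hx
    apply hδh
    have hx2 : sq2 p x < δ * δ := by
      have := min_le_left (δ * δ / 2) (s0 / 2)
      have : 0 < δ * δ := by positivity
      linarith
    unfold sq2 at hx2
    rw [Prod.dist_eq, Real.dist_eq, Real.dist_eq]
    refine max_lt ?_ ?_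
    · apply abs_lt_of_sq_lt_sq _ hδ.le
      nlinarith [mul_self_nonneg (x.2 - p.2)]
    · apply abs_lt_of_sq_lt_sq _ hδ.le
      nlinarith [mul_self_nonneg (x.1 - p.1)]
  -- the big disk is inside the ball
  have hin : ∀ x, sq2 p x ≤ 4 * s0 → x ∈ ball (0 : ℝ × ℝ) r := by
    intro x hx
    have b1 : p.1 * p.1 ≤ (r / 8) ^ 2 := by
      rw [← abs_mul_abs_self, sq]
      exact mul_self_le_mul_self (abs_nonneg _) hp1.1.le
    have b2 : p.2 * p.2 ≤ (r / 8) ^ 2 := by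
      rw [← abs_mul_abs_self, sq]
      exact mul_self_le_mul_self (abs_nonneg _) hp1.2.le
    have b3 : sq2 p x < (r / 2) ^ 2 := by nlinarith
    unfold sq2 at b3
    have a1 : |x.1 - p.1| < r / 2 := by
      apply abs_lt_of_sq_lt_sq _ (by positivity)
      nlinarith [mul_self_nonneg (x.2 - p.2)]
    have a2 : |x.2 - p.2| < r / 2 := by
      apply abs_lt_of_sq_lt_sq _ (by positivity)
      nlinarith [mul_self_nonneg (x.1 - p.1)]
    rw [mem_ball, dist_zero_right, Prod.norm_def, Real.norm_eq_abs, Real.norm_eq_abs]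
    have h1 := abs_sub_abs_le_abs_sub x.1 p.1
    have h2 := abs_sub_abs_le_abs_sub x.2 p.2
    exact max_lt (by linarith [hp1.1]) (by linarith [hp1.2])
  -- choose α
  set α := (C + 2) / d + 1 with hα
  have hα1 : 1 ≤ α := by
    have : 0 ≤ (C + 2) / d := by positivity
    linarith
  have hαd : C + 2 ≤ α * d := by
    have : (C + 2) / d * d = C + 2 := div_mul_cancel₀ _ hdpos.ne'
    rw [hα]; nlinarith
  set ε := h p / 2 with hε
  have hεp : 0 < ε := by positivity
  set c0 := Real.exp (-α * (4 * s0)) with hc0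
  have hc0p : 0 < c0 := Real.exp_pos _
  set b : ℝ × ℝ → ℝ := fun x => ε * (gw α p x - c0) with hb
  have gsm := gw_sm α p
  have bsm : Sm b := contDiff_const.mul (gsm.sub contDiff_const)
  have blap : ∀ x, lap b x = ε * ((4 * α ^ 2 * sq2 p x - 4 * α) * gw α p x) := by
    intro x
    rw [hb, lap_const_mul _ (gsm.sub contDiff_const).contDiffAt,
      lap_sub gsm.contDiffAt contDiffAt_const, lap_const, lap_gw, sub_zero]
  set K : Set (ℝ × ℝ) := {x | d ≤ sq2 p x ∧ sq2 p x ≤ 4 * s0} with hK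
  have hKc : IsCompact K := by
    refine Metric.isCompact_of_isClosed_isBounded
      ((isClosed_le continuous_const hsc).inter (isClosed_le hsc continuous_const)) ?_
    exact isBounded_ball.subset fun x hx => hin x hx.2
  have h0K : (0 : ℝ × ℝ) ∈ K := by
    refine ⟨?_, ?_⟩
    · have := min_le_right (δ * δ / 2) (s0 / 2)
      linarith
    · linarith
  have hcont : ContinuousOn (fun x => h x - b x) K :=
    (hh.continuousOn.mono fun x hx => hin x hx.2).sub bsm.continuous.continuousOn
  obtain ⟨x0, hx0K, hx0⟩ := hKc.exists_isMinOn ⟨0, h0K⟩ hcont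
  have hb0 : 0 < b 0 := by
    apply mul_pos hεp
    rw [sub_pos, hc0]
    apply Real.exp_lt_exp.2
    nlinarith
  have hneg : h x0 - b x0 < 0 := by
    have : h x0 - b x0 ≤ h 0 - b 0 := hx0 h0K
    linarith
  have hx0r := hin x0 hx0K.2
  have hlt1 : d < sq2 p x0 := by
    refine lt_of_le_of_ne hx0K.1 fun heq => ?_
    have h1 := hdd x0 heq.symm.le
    have h2 : gw α p x0 ≤ 1 := Real.exp_le_one_iff.2 (by nlinarith)
    have h3 : b x0 ≤ ε * 1 := mul_le_mul_of_nonneg_left (by linarith) hεp.le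
    linarith
  have hlt2 : sq2 p x0 < 4 * s0 := by
    refine lt_of_le_of_ne hx0K.2 fun heq => ?_
    have : b x0 = 0 := by simp [hb, gw, heq, hc0]
    have := hnn x0 hx0r
    linarith
  have hloc : IsLocalMin (fun x => h x - b x) x0 := by
    refine hx0.isLocalMin ?_
    filter_upwards [hsc.continuousAt.eventually (lt_mem_nhds hlt1),
      hsc.continuousAt.eventually (gt_mem_nhds hlt2)] with x h1 h2
    exact ⟨h1.le, h2.le⟩
  have hhat : ContDiffAt ℝ (⊤ : ℕ∞) h x0 := hh.contDiffAt (isOpen_ball.mem_nhds hx0r)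
  have hL := lap_nonneg (hhat.sub bsm.contDiffAt) hloc
  rw [lap_sub hhat bsm.contDiffAt, blap] at hL
  have hL2 := hl x0 hx0r
  have hgp : 0 < gw α p x0 := Real.exp_pos _
  have h7 : C ≤ 4 * α ^ 2 * sq2 p x0 - 4 * α := by
    have h8 : C + 2 ≤ α * sq2 p x0 := hαd.trans (mul_le_mul_of_nonneg_left hlt1.le (by linarith))
    have h9 : 4 * α * (C + 2) ≤ 4 * α * (α * sq2 p x0) := mul_le_mul_of_nonneg_left h8 (by linarith)
    nlinarith
  have h10 : ε * (C * gw α p x0) ≤ ε * ((4 * α ^ 2 * sq2 p x0 - 4 * α) * gw α p x0) :=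
    mul_le_mul_of_nonneg_left (mul_le_mul_of_nonneg_right h7 hgp.le) hεp.le
  have h11 : C * h x0 ≤ C * b x0 := mul_le_mul_of_nonneg_left (by linarith) hC0
  have h12 : C * b x0 = ε * (C * gw α p x0) - C * ε * c0 := by rw [hb]; ring
  -- strictness
  have h13 : C + 1 ≤ 4 * α ^ 2 * sq2 p x0 - 4 * α := by
    have h8 : C + 2 ≤ α * sq2 p x0 := hαd.trans (mul_le_mul_of_nonneg_left hlt1.le (by linarith))
    have h9 : 4 * α * (C + 2) ≤ 4 * α * (α * sq2 p x0) := mul_le_mul_of_nonneg_left h8 (by linarith)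
    nlinarith
  have h14 : ε * ((C + 1) * gw α p x0) ≤ ε * ((4 * α ^ 2 * sq2 p x0 - 4 * α) * gw α p x0) :=
    mul_le_mul_of_nonneg_left (mul_le_mul_of_nonneg_right h13 hgp.le) hεp.le
  have h15 : 0 < ε * gw α p x0 := mul_pos hεp hgp
  have h16 : 0 ≤ C * ε * c0 := by positivity
  nlinarith

lemma pdx_eq {u : ℝ → ℝ → ℝ} {F : ℝ × ℝ → ℝ} {x y : ℝ}
    (hF : DifferentiableAt ℝ F (x, y)) (h : (fun p : ℝ × ℝ => u p.1 p.2) =ᶠ[nhds (x, y)] F) :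
    pdx u x y = dd (1,0) F (x, y) := by
  have h1 : HasDerivAt (fun t : ℝ => (t, y)) ((1 : ℝ), (0 : ℝ)) x :=
    (hasDerivAt_id x).prodMk (hasDerivAt_const x y)
  have h2 : HasDerivAt (fun t => F (t, y)) (dd (1,0) F (x, y)) x :=
    hF.hasFDerivAt.comp_hasDerivAt x h1
  have h3 : (fun t => u t y) =ᶠ[nhds x] fun t => F (t, y) := by
    have := h1.continuousAt.tendsto.eventually h
    exact this
  unfold pdx
  rw [h3.deriv_eq, h2.deriv]

lemma pdy_eq {u : ℝ → ℝ → ℝ} {F : ℝ × ℝ → ℝ} {x y : ℝ}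
    (hF : DifferentiableAt ℝ F (x, y)) (h : (fun p : ℝ × ℝ => u p.1 p.2) =ᶠ[nhds (x, y)] F) :
    pdy u x y = dd (0,1) F (x, y) := by
  have h1 : HasDerivAt (fun t : ℝ => (x, t)) ((0 : ℝ), (1 : ℝ)) y :=
    (hasDerivAt_const y x).prodMk (hasDerivAt_id y)
  have h2 : HasDerivAt (fun t => F (x, t)) (dd (0,1) F (x, y)) y :=
    hF.hasFDerivAt.comp_hasDerivAt y h1
  have h3 : (fun t => u x t) =ᶠ[nhds y] fun t => F (x, t) := by
    have := h1.continuousAt.tendsto.eventually h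
    exact this
  unfold pdy
  rw [h3.deriv_eq, h2.deriv]

lemma lap_eq_pd {u : ℝ → ℝ → ℝ} {x y : ℝ}
    (hu : ContDiffAt ℝ (⊤ : ℕ∞) (fun p : ℝ × ℝ => u p.1 p.2) (x, y)) :
    pd u 2 0 x y = dd (1,0) (dd (1,0) (fun p : ℝ × ℝ => u p.1 p.2)) (x, y) ∧
    pd u 0 2 x y = dd (0,1) (dd (0,1) (fun p : ℝ × ℝ => u p.1 p.2)) (x, y) := by
  constructor
  · refine pdx_eq (u := pdx u) ((dd_contDiffAt _ hu).differentiableAt (by simp)) ?_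
    filter_upwards [ev_diff hu] with p hp
    exact pdx_eq hp (Eventually.of_forall fun _ => rfl)
  · refine pdy_eq (u := pdy u) ((dd_contDiffAt _ hu).differentiableAt (by simp)) ?_
    filter_upwards [ev_diff hu] with p hp
    exact pdy_eq hp (Eventually.of_forall fun _ => rfl)

lemma lip_bound {U : ℝ × ℝ → ℝ} {f : ℝ → ℝ} (hf : ContDiff ℝ (⊤ : ℕ∞) f) {K : Set (ℝ × ℝ)}
    (hK : IsCompact K) (hU : ContinuousOn U K) (c : ℝ) :
    ∃ L, 0 ≤ L ∧ ∀ p ∈ K, |f (U p) - f c| ≤ L * |U p - c| := by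
  obtain ⟨M, hM⟩ := hK.exists_bound_of_continuousOn hU
  set N := max M |c| with hN
  have hfd : Continuous (deriv f) := hf.continuous_deriv (by simp)
  obtain ⟨L, hL⟩ := (isCompact_Icc (a := -N) (b := N)).exists_bound_of_continuousOn
    hfd.continuousOn
  refine ⟨max L 0, le_max_right _ _, fun p hp => ?_⟩
  have h1 : U p ∈ Icc (-N) N := abs_le.1 ((hM p hp).trans (le_max_left _ _))
  have h2 : c ∈ Icc (-N) N := abs_le.1 (le_max_right _ _)
  exact (convex_Icc (-N) N).norm_image_sub_le_of_norm_deriv_le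
    (fun x _ => (hf.differentiable (by simp)) x) (fun x hx => (hL x hx).trans (le_max_left _ _)) h2 h1

/-- Morse Lemma for degenerate maximum points, first part:
if `u` is a nonconstant solution of `-Δu = f(u)` in `B₁` and `(0,0)` is a degenerate
critical point of `u` which is a local maximum, with `u_xx(0,0) = u_xy(0,0) = 0`,
then `u_yy(0,0) < 0`. -/
theorem degenerate_max_uyy_neg
    (u : ℝ → ℝ → ℝ) (f : ℝ → ℝ)
    (hu : ContDiffOn ℝ (⊤ : ℕ∞) (fun p : ℝ × ℝ => u p.1 p.2) B1)
    (hf : ContDiff ℝ (⊤ : ℕ∞) f)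
    (hpde : ∀ x y : ℝ, (x, y) ∈ B1 → -(pd u 2 0 x y + pd u 0 2 x y) = f (u x y))
    (hnc : ¬ ∃ c : ℝ, ∀ x y : ℝ, (x, y) ∈ B1 → u x y = c)
    (hcx : pd u 1 0 0 0 = 0) (hcy : pd u 0 1 0 0 = 0)
    (hmax : IsLocalMax (fun p : ℝ × ℝ => u p.1 p.2) (0, 0))
    (hdeg : pd u 2 0 0 0 * pd u 0 2 0 0 - (pd u 1 1 0 0) ^ 2 = 0)
    (hxx : pd u 2 0 0 0 = 0) (hxy : pd u 1 1 0 0 = 0) :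
    pd u 0 2 0 0 < 0 := by
  set U : ℝ × ℝ → ℝ := fun p => u p.1 p.2 with hU
  have hB : IsOpen B1 := isOpen_ball
  have hat : ∀ p ∈ B1, ContDiffAt ℝ (⊤ : ℕ∞) U p := fun p hp => hu.contDiffAt (hB.mem_nhds hp)
  have hlap : ∀ p ∈ B1, lap U p = - f (U p) := by
    intro p hp
    have h1 := lap_eq_pd (u := u) (x := p.1) (y := p.2) (hat p hp)
    have h2 := hpde p.1 p.2 hp
    rw [h1.1, h1.2] at h2
    have : lap U p = - -(lap U p) := by ring
    rw [this]
    exact congrArg Neg.neg h2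
  have h0B : (0 : ℝ × ℝ) ∈ B1 := mem_ball_self one_pos
  have hcd : ∀ p ∈ B1, ContDiffAt ℝ (⊤ : ℕ∞) (fun _ : ℝ × ℝ => U 0) p :=
    fun p _ => contDiffAt_const
  -- the second derivative is nonpositive
  have hle : pd u 0 2 0 0 ≤ 0 := by
    have h1 := (lap_eq_pd (u := u) (x := 0) (y := 0) (hat 0 h0B)).2
    have hmin : IsLocalMin (fun p => -U p) 0 := IsLocalMax.neg hmax
    have h2 := lap_nonneg (hat 0 h0B).neg hmin
    have h3 : lap (fun p => -U p) 0 = - lap U 0 := by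
      have := lap_const_mul (-1) (hat 0 h0B)
      simpa using this
    have h4 : lap U 0 = pd u 2 0 0 0 + pd u 0 2 0 0 := by
      rw [(lap_eq_pd (u := u) (x := 0) (y := 0) (hat 0 h0B)).1, h1]; rfl
    linarith
  refine lt_of_le_of_ne hle fun hyy => hnc ?_
  have hfc : f (U 0) = 0 := by
    have := hpde 0 0 h0B
    rw [hxx, hyy] at this
    have h2 : f (u 0 0) = 0 := by simpa using this.symm
    exact h2
  set c := U 0 with hc
  set W : ℝ × ℝ → ℝ := fun p => U p - c with hW
  have hWs : ContDiffOn ℝ (⊤ : ℕ∞) W B1 := hu.sub contDiffOn_const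
  have hWl : ∀ p ∈ B1, lap W p = -(f (U p) - f c) := by
    intro p hp
    rw [hW, lap_sub (hat p hp) contDiffAt_const, lap_const, hlap p hp, hfc]
    ring
  -- local vanishing
  have hloc : W =ᶠ[nhds 0] fun _ => 0 := by
    obtain ⟨r1, hr1, hr1'⟩ := Metric.eventually_nhds_iff.1 hmax
    set r := min r1 (1 / 2) with hr
    have hrpos : 0 < r := lt_min hr1 (by norm_num)
    have hsub : closedBall (0 : ℝ × ℝ) r ⊆ B1 :=
      closedBall_subset_ball (lt_of_le_of_lt (min_le_right _ _) (by norm_num))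
    obtain ⟨L, hL0, hL⟩ := lip_bound hf (isCompact_closedBall (0 : ℝ × ℝ) r)
      (hu.continuousOn.mono hsub) c
    have hsub' : ball (0 : ℝ × ℝ) r ⊆ B1 := ball_subset_closedBall.trans hsub
    have hnn : ∀ p ∈ ball (0 : ℝ × ℝ) r, 0 ≤ -W p := by
      intro p hp
      have : U p ≤ U 0 := hr1' (lt_of_lt_of_le hp (min_le_left _ _))
      simp only [hW]; linarith
    have key := strong_min (h := fun p => -W p) (r := r) hL0 ((hWs.mono hsub').neg) hnn (by
      intro p hp
      have h3 : lap (fun p => -W p) p = - lap W p := by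
        have := lap_const_mul (-1) (hWs.contDiffAt (hB.mem_nhds (hsub' hp)))
        simpa using this
      have h4 := hL p (ball_subset_closedBall hp)
      have h5 : |U p - c| = -W p := by
        rw [abs_of_nonpos (by have := hnn p hp; simp only [hW] at this; linarith)]
      rw [h5] at h4
      rw [h3, hWl p (hsub' hp)]
      linarith [le_abs_self (f (U p) - f c)]) (by simp [hW, hc])
    filter_upwards [ball_mem_nhds (0 : ℝ × ℝ) (show 0 < r / 8 by positivity)] with p hp
    have := key p hp
    linarith
  -- propagation
  set Z : Set (ℝ × ℝ) := {p | W =ᶠ[nhds p] fun _ => 0} with hZ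
  have hZo : IsOpen Z := by
    rw [isOpen_iff_mem_nhds]
    intro p hp
    exact Filter.Eventually.eventually_nhds hp
  have hconn : IsPreconnected B1 := (convex_ball (0 : ℝ × ℝ) 1).isPreconnected
  have hsubZ : B1 ⊆ Z := by
    refine hconn.subset_of_closure_inter_subset hZo ⟨0, h0B, hloc⟩ ?_
    rintro p ⟨hpc, hpB⟩
    obtain ⟨η, hη, hηB⟩ := Metric.isOpen_iff.1 hB p hpB
    set ρ := η / 5 with hρ
    have hρ0 : 0 < ρ := by positivity
    obtain ⟨q, hqZ, hq⟩ := Metric.mem_closure_iff.1 hpc (ρ / 2) (by positivity)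
    have hsub : closedBall q (2 * ρ) ⊆ B1 := by
      refine Subset.trans (fun x hx => ?_) hηB
      have h1 : dist x q ≤ 2 * ρ := hx
      have h2 := dist_triangle x q p
      rw [dist_comm q p] at h2
      show dist x p < η
      linarith
    obtain ⟨L, hL0, hL⟩ := lip_bound hf (isCompact_closedBall q (2 * ρ))
      (hu.continuousOn.mono hsub) c
    have key := ucp_ball hB hWs q hρ0 (C := L ^ 2) (by positivity) hsub hqZ (by
      intro x hx
      have h1 := hL x hx
      rw [hWl x (hsub hx)]
      have h2 := mul_self_le_mul_self (abs_nonneg _) h1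
      rw [abs_mul_abs_self] at h2
      have h3 : L * |U x - c| * (L * |U x - c|) = L ^ 2 * (W x * W x) := by
        rw [← abs_mul_abs_self (W x)]; simp only [hW]; ring
      rw [h3] at h2
      linarith)
    have hpq : sq2 q p < ρ * ρ := by
      rw [Prod.dist_eq, Real.dist_eq, Real.dist_eq] at hq
      obtain ⟨h1, h2⟩ := max_lt_iff.1 hq
      have h3 := mul_self_le_mul_self (abs_nonneg _) h1.le
      have h4 := mul_self_le_mul_self (abs_nonneg _) h2.le
      rw [abs_mul_abs_self] at h3 h4
      unfold sq2
      nlinarith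
    filter_upwards [(sq2_sm q).continuous.continuousAt.eventually (gt_mem_nhds hpq)] with x hx
    exact key x hx
  refine ⟨c, fun x y hxy' => ?_⟩
  have h1 : W (x, y) = 0 := (hsubZ hxy').eq_of_nhds
  simp only [hW, hU] at h1
  linarith
end

section
/- Let u be a nonconstant solution of -Δu = f(u) in B₁ with (0,0) a degenerate local maximum point satisfying u_xx(0,0) = u_xy(0,0) = 0, and assume ∂u/∂x ≢ 0 on B₁. Let n ≥ 3 be the smallest integer such that ∂ⁿu/∂x^{n-k}∂y^k(0,0) ≠ 0 for some k ∈ {0,…,n-1}, and suppose n is odd; let l be the smallest integer l > n with ∂ˡu/∂xˡ(0,0) ≠ 0 (so n+1 ≤ l ≤ 2n-2). Then there exist functions ε₁, ε₂, ε₃ defined near the origin with ε_i(x,y) → 0 as (x,y) → (0,0), such that u(x,y) = u(0,0) + (u_yy(0,0)/2 + ε₁(x,y)) y² + (∂ⁿu/∂x^{n-1}∂y(0,0)/n! + ε₂(x,y)) Im(zⁿ) + (∂ˡu/∂xˡ(0,0)/l! + ε₃(x,y)) Re(zˡ), where z = x + iy. -/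
open Filter Metric Set

lemma z_expand (m : ℕ) : ∃ P Q : ℝ × ℝ → ℝ, Continuous P ∧ Continuous Q ∧ P 0 = 0 ∧ Q 0 = 0 ∧
    ∀ x y : ℝ, ReZ (m + 3) x y = x ^ (m + 3) + y ^ 2 * P (x, y) ∧
      ImZ (m + 3) x y = ((m : ℝ) + 3) * x ^ (m + 2) * y + y ^ 2 * Q (x, y) := by
  induction m with
  | zero =>
    refine ⟨fun p => -3 * p.1, fun p => - p.2, by fun_prop, by fun_prop, by simp, by simp, ?_⟩
    intro x y
    simp only [ReZ, ImZ, zero_add, pow_succ, pow_zero, one_mul]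
    constructor <;> simp <;> ring
  | succ m ih =>
    obtain ⟨P, Q, hP, hQ, hP0, hQ0, h⟩ := ih
    refine ⟨fun p => p.1 * P p - ((m : ℝ) + 3) * p.1 ^ (m + 2) - p.2 * Q p,
      fun p => p.1 * Q p + p.2 * P p, by fun_prop, by fun_prop, by simp, by simp, ?_⟩
    intro x y
    obtain ⟨h1, h2⟩ := h x y
    have e1 : ReZ (m + 1 + 3) x y = x * ReZ (m + 3) x y - y * ImZ (m + 3) x y := by
      simp only [ReZ, ImZ]
      rw [show m + 1 + 3 = (m + 3) + 1 by ring, pow_succ, Complex.mul_re]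
      simp
      ring
    have e2 : ImZ (m + 1 + 3) x y = x * ImZ (m + 3) x y + y * ReZ (m + 3) x y := by
      simp only [ReZ, ImZ]
      rw [show m + 1 + 3 = (m + 3) + 1 by ring, pow_succ, Complex.mul_im]
      simp
      ring
    rw [e1, e2, h1, h2]
    push_cast
    constructor <;> ring

lemma peano (g : ℝ → ℝ) (hg : ContDiffOn ℝ (⊤ : ℕ∞) g (Ioo (-1) 1)) (N : ℕ) (hN : 0 < N)
    (h0 : ∀ m, 0 < m → m < N → deriv^[m] g 0 = 0) :
    ∃ η : ℝ → ℝ, Tendsto η (nhds 0) (nhds 0) ∧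
      ∀ x, g x = g 0 + (deriv^[N] g 0 / (N.factorial : ℝ) + η x) * x ^ N := by
  have hmem : (0 : ℝ) ∈ Ioo (-1 : ℝ) 1 := by constructor <;> norm_num
  have hT := Real.taylor_tendsto (n := N) (convex_Ioo (-1 : ℝ) 1) hmem
    (hg.of_le (by exact_mod_cast le_top))
  rw [isOpen_Ioo.nhdsWithin_eq hmem] at hT
  have hE : ∀ x, taylorWithinEval g N (Ioo (-1) 1) 0 x
      = g 0 + deriv^[N] g 0 / (N.factorial : ℝ) * x ^ N := by
    intro x
    rw [taylor_within_apply, Finset.sum_range_succ, Finset.sum_eq_single 0]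
    · rw [iteratedDerivWithin_of_isOpen_eq_iterate (n := N) isOpen_Ioo hmem]
      simp
      ring
    · intro b hb hb0
      rw [iteratedDerivWithin_of_isOpen_eq_iterate isOpen_Ioo hmem,
        h0 b (Nat.pos_of_ne_zero hb0) (Finset.mem_range.1 hb)]
      simp
    · intro h
      exact absurd (Finset.mem_range.2 hN) h
  refine ⟨_, hT, ?_⟩
  intro x
  rw [hE]
  rcases eq_or_ne x 0 with rfl | hx
  · simp [hN.ne']
  · have : x ^ N ≠ 0 := pow_ne_zero _ hx
    rw [sub_zero]
    field_simp
    ring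

lemma odd_coeff (g : ℝ → ℝ) (η : ℝ → ℝ) (c : ℝ) (n : ℕ) (hn : Odd n)
    (hη : Tendsto η (nhds 0) (nhds 0)) (h : ∀ x, g x = g 0 + (c + η x) * x ^ n)
    (hmax : ∀ᶠ x in nhds 0, g x ≤ g 0) : c = 0 := by
  have hT : Tendsto (fun x => c + η x) (nhds 0) (nhds c) := by
    simpa using hη.const_add c
  apply le_antisymm
  · refine le_of_tendsto (hT.mono_left (nhdsWithin_le_nhds (s := Ioi 0))) ?_
    filter_upwards [nhdsWithin_le_nhds hmax, self_mem_nhdsWithin] with x hx hx0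
    have hp : 0 < x ^ n := pow_pos hx0 n
    rw [h x] at hx
    by_contra hc
    push Not at hc
    nlinarith [mul_pos hc hp]
  · refine ge_of_tendsto (hT.mono_left (nhdsWithin_le_nhds (s := Iio 0))) ?_
    filter_upwards [nhdsWithin_le_nhds hmax, self_mem_nhdsWithin] with x hx hx0
    have hp : x ^ n < 0 := hn.pow_neg hx0
    rw [h x] at hx
    by_contra hc
    push Not at hc
    nlinarith [mul_pos_of_neg_of_neg hc hp]

lemma pdx_iter (v : ℝ → ℝ → ℝ) (m : ℕ) (x y : ℝ) :
    (pdx^[m] v) x y = deriv^[m] (fun t => v t y) x := by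
  induction m generalizing v with
  | zero => rfl
  | succ m ih => rw [Function.iterate_succ_apply, Function.iterate_succ_apply, ih]; rfl

lemma mem_B1 (x y : ℝ) : (x, y) ∈ B1 ↔ |x| < 1 ∧ |y| < 1 := by
  simp [B1, Prod.norm_def]

lemma pdy_hasDeriv (u : ℝ → ℝ → ℝ)
    (hu : ContDiffOn ℝ (⊤ : ℕ∞) (fun p : ℝ × ℝ => u p.1 p.2) B1) (x y : ℝ) (h : (x, y) ∈ B1) :
    HasDerivAt (fun t => u x t) (fderiv ℝ (fun p : ℝ × ℝ => u p.1 p.2) (x, y) (0, 1)) y := by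
  have hd : DifferentiableAt ℝ (fun p : ℝ × ℝ => u p.1 p.2) (x, y) :=
    (hu.contDiffAt (isOpen_ball.mem_nhds h)).differentiableAt (by simp)
  have h2 : HasDerivAt (fun t : ℝ => (x, t)) ((0 : ℝ), (1 : ℝ)) y :=
    (hasDerivAt_const y x).prodMk (hasDerivAt_id y)
  exact HasFDerivAt.comp_hasDerivAt (f := fun t : ℝ => (x, t)) y hd.hasFDerivAt h2

lemma pdy_hasDeriv' (u : ℝ → ℝ → ℝ)
    (hu : ContDiffOn ℝ (⊤ : ℕ∞) (fun p : ℝ × ℝ => u p.1 p.2) B1) (x y : ℝ) (h : (x, y) ∈ B1) :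
    HasDerivAt (fun t => u x t) (pdy u x y) y :=
  (pdy_hasDeriv u hu x y h).differentiableAt.hasDerivAt

lemma pdy_contDiff (u : ℝ → ℝ → ℝ)
    (hu : ContDiffOn ℝ (⊤ : ℕ∞) (fun p : ℝ × ℝ => u p.1 p.2) B1) :
    ContDiffOn ℝ (⊤ : ℕ∞) (fun p : ℝ × ℝ => pdy u p.1 p.2) B1 := by
  have h1 : ContDiffOn ℝ (⊤ : ℕ∞) (fderiv ℝ (fun p : ℝ × ℝ => u p.1 p.2)) B1 :=
    hu.fderiv_of_isOpen isOpen_ball (by simp)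
  have h2 : ContDiffOn ℝ (⊤ : ℕ∞)
      (fun p => fderiv ℝ (fun p : ℝ × ℝ => u p.1 p.2) p ((0 : ℝ), (1 : ℝ))) B1 :=
    h1.clm_apply contDiffOn_const
  refine h2.congr ?_
  rintro ⟨x, y⟩ h
  exact (pdy_hasDeriv u hu x y h).deriv

lemma slice_contDiff (v : ℝ → ℝ → ℝ)
    (hv : ContDiffOn ℝ (⊤ : ℕ∞) (fun p : ℝ × ℝ => v p.1 p.2) B1) :
    ContDiffOn ℝ (⊤ : ℕ∞) (fun t => v t 0) (Ioo (-1) 1) := by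
  refine hv.comp (f := fun t : ℝ => (t, (0 : ℝ))) (by fun_prop) ?_
  intro t ht
  rw [mem_B1]
  exact ⟨abs_lt.2 ht, by simp⟩

lemma y_taylor (u : ℝ → ℝ → ℝ)
    (hu : ContDiffOn ℝ (⊤ : ℕ∞) (fun p : ℝ × ℝ => u p.1 p.2) B1) :
    ∃ ε : ℝ × ℝ → ℝ, Tendsto ε (nhds 0) (nhds 0) ∧
      ∀ x y, u x y = u x 0 + y * pdy u x 0 + (pdy (pdy u) 0 0 / 2 + ε (x, y)) * y ^ 2 := by
  set c := pdy (pdy u) 0 0 with hc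
  have hu1 := pdy_contDiff u hu
  have hu2 := pdy_contDiff _ hu1
  refine ⟨fun p => if p.2 = 0 then 0 else
    (u p.1 p.2 - u p.1 0 - p.2 * pdy u p.1 0) / p.2 ^ 2 - c / 2, ?_, ?_⟩
  swap
  · intro x y
    by_cases hy : y = 0
    · simp [hy]
    · simp only [hy, if_false]
      field_simp
      ring
  have h0 : (0 : ℝ × ℝ) ∈ B1 := by simp [B1]
  have hcont : ContinuousAt (fun p : ℝ × ℝ => pdy (pdy u) p.1 p.2) 0 :=
    (hu2.contDiffAt (isOpen_ball.mem_nhds h0)).continuousAt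
  rw [Metric.tendsto_nhds_nhds]
  intro e he
  obtain ⟨d, hd, hd2⟩ := Metric.continuousAt_iff.1 hcont (e / 2) (by positivity)
  refine ⟨min d 1, by positivity, ?_⟩
  rintro ⟨x, y⟩ hxy
  have hxy' : |x| < min d 1 ∧ |y| < min d 1 := by
    rw [dist_zero_right, Prod.norm_def, sup_lt_iff] at hxy
    exact hxy
  by_cases hy : y = 0
  · simpa [hy] using he
  simp only [hy, if_false]
  have hB : ∀ t : ℝ, |t| ≤ |y| → (x, t) ∈ B1 := fun t ht => (mem_B1 _ _).2
    ⟨hxy'.1.trans_le (min_le_right _ _), (ht.trans_lt hxy'.2).trans_le (min_le_right _ _)⟩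
  have hsm : ∀ t : ℝ, |t| ≤ |y| → |pdy (pdy u) x t - c| ≤ e / 2 := by
    intro t ht
    have := @hd2 (x, t) (by
      simp only [dist_zero_right, Prod.norm_def, Real.norm_eq_abs, sup_lt_iff]
      exact ⟨hxy'.1.trans_le (min_le_left _ _), (ht.trans_lt hxy'.2).trans_le (min_le_left _ _)⟩)
    exact this.le
  have hcvx : Convex ℝ (Icc (-|y|) |y|) := convex_Icc _ _
  have hz : (0 : ℝ) ∈ Icc (-|y|) |y| := ⟨by simp, by simp⟩
  -- first derivative estimate
  have step1 : ∀ t ∈ Icc (-|y|) |y|, ‖pdy u x t - pdy u x 0 - c * t‖ ≤ e / 2 * |y| := by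
    intro t ht
    have := hcvx.norm_image_sub_le_of_norm_hasDerivWithin_le
      (f := fun t => pdy u x t - pdy u x 0 - c * t) (f' := fun t => pdy (pdy u) x t - c)
      (C := e / 2) (x := 0) (y := t)
      (fun s hs => by
        have h1 := pdy_hasDeriv' _ hu1 x s (hB s (abs_le.2 hs))
        have h2 := (h1.sub_const (pdy u x 0)).sub ((hasDerivAt_id s).const_mul c)
        refine (h2.congr_deriv ?_).hasDerivWithinAt
        simp)
      (fun s hs => hsm s (abs_le.2 hs)) hz ht
    simp only [sub_self, mul_zero, sub_zero] at this
    refine this.trans ?_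
    have := abs_le.2 ht
    rw [Real.norm_eq_abs]
    gcongr
  have hyI : y ∈ Icc (-|y|) |y| := abs_le.1 le_rfl
  have step2 := hcvx.norm_image_sub_le_of_norm_hasDerivWithin_le
      (f := fun t => u x t - u x 0 - t * pdy u x 0 - c / 2 * t ^ 2)
      (f' := fun t => pdy u x t - pdy u x 0 - c * t)
      (C := e / 2 * |y|) (x := 0) (y := y)
      (fun s hs => by
        have h1 := pdy_hasDeriv' _ hu x s (hB s (abs_le.2 hs))
        have h2 := ((h1.sub_const (u x 0)).sub ((hasDerivAt_id s).mul_const (pdy u x 0))).sub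
          ((hasDerivAt_pow 2 s).const_mul (c / 2))
        refine (h2.congr_deriv ?_).hasDerivWithinAt
        simp
        ring)
      step1 hz hyI
  have hy2 : 0 < y ^ 2 := by positivity
  have e1 : (u x y - u x 0 - y * pdy u x 0) / y ^ 2 - c / 2
      = (u x y - u x 0 - y * pdy u x 0 - c / 2 * y ^ 2) / y ^ 2 := by
    field_simp
  rw [dist_zero_right, Real.norm_eq_abs, e1, abs_div, abs_of_pos hy2, div_lt_iff₀ hy2]
  have e2 : e / 2 * |y| * |y| = e / 2 * y ^ 2 := by
    rw [mul_assoc, abs_mul_abs_self]; ring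
  simp only [sub_self, zero_mul, sub_zero, ne_eq, OfNat.ofNat_ne_zero, not_false_eq_true,
    zero_pow, mul_zero, Real.norm_eq_abs] at step2
  rw [e2] at step2
  nlinarith

/-- Morse Lemma for degenerate maximum points, expansion in the case `n` odd. -/
theorem degenerate_max_expansion_odd
    (u : ℝ → ℝ → ℝ) (f : ℝ → ℝ)
    (hu : ContDiffOn ℝ (⊤ : ℕ∞) (fun p : ℝ × ℝ => u p.1 p.2) B1)
    (hf : ContDiff ℝ (⊤ : ℕ∞) f)
    (hpde : ∀ x y : ℝ, (x, y) ∈ B1 → -(pd u 2 0 x y + pd u 0 2 x y) = f (u x y))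
    (hnc : ¬ ∃ c : ℝ, ∀ x y : ℝ, (x, y) ∈ B1 → u x y = c)
    (hcx : pd u 1 0 0 0 = 0) (hcy : pd u 0 1 0 0 = 0)
    (hmax : IsLocalMax (fun p : ℝ × ℝ => u p.1 p.2) (0, 0))
    (hdeg : pd u 2 0 0 0 * pd u 0 2 0 0 - (pd u 1 1 0 0) ^ 2 = 0)
    (hxx : pd u 2 0 0 0 = 0) (hxy : pd u 1 1 0 0 = 0)
    (hux : ¬ ∀ x y : ℝ, (x, y) ∈ B1 → pd u 1 0 x y = 0)
    (n : ℕ) (hn3 : 3 ≤ n)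
    (hnex : ∃ k, k < n ∧ pd u (n - k) k 0 0 ≠ 0)
    (hnmin : ∀ m, 3 ≤ m → m < n → ∀ k, k < m → pd u (m - k) k 0 0 = 0)
    (hnodd : Odd n)
    (l : ℕ) (hln : n < l) (hl2n : l ≤ 2 * n - 2)
    (hlne : pd u l 0 0 0 ≠ 0)
    (hlmin : ∀ m : ℕ, n < m → m < l → pd u m 0 0 0 = 0) :
    ∃ ε₁ ε₂ ε₃ : ℝ × ℝ → ℝ,
      Filter.Tendsto ε₁ (nhds (0 : ℝ × ℝ)) (nhds 0) ∧
      Filter.Tendsto ε₂ (nhds (0 : ℝ × ℝ)) (nhds 0) ∧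
      Filter.Tendsto ε₃ (nhds (0 : ℝ × ℝ)) (nhds 0) ∧
      ∀ᶠ p : ℝ × ℝ in nhds 0,
        u p.1 p.2 = u 0 0 + (pd u 0 2 0 0 / 2 + ε₁ p) * p.2 ^ 2
          + (pd u (n - 1) 1 0 0 / (n.factorial : ℝ) + ε₂ p) * ImZ n p.1 p.2
          + (pd u l 0 0 0 / (l.factorial : ℝ) + ε₃ p) * ReZ l p.1 p.2 := by
  have hu1 := pdy_contDiff u hu
  have hg0 := slice_contDiff u hu
  have hg1 := slice_contDiff _ hu1
  have hpd0 : ∀ m, deriv^[m] (fun t => u t 0) 0 = pd u m 0 0 0 := fun m =>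
    (pdx_iter u m 0 0).symm
  have hpd1 : ∀ m, deriv^[m] (fun t => pdy u t 0) 0 = pd u m 1 0 0 := fun m =>
    (pdx_iter (pdy u) m 0 0).symm
  have hlow : ∀ m, 0 < m → m < n → pd u m 0 0 0 = 0 := by
    intro m h1 h2
    rcases (by omega : m = 1 ∨ m = 2 ∨ 3 ≤ m) with rfl | rfl | h3
    · exact hcx
    · exact hxx
    · exact hnmin m h3 h2 0 h1
  -- the coefficient of x^n vanishes because n is odd
  have hn0 : pd u n 0 0 0 = 0 := by
    obtain ⟨η, hη, he⟩ := peano _ hg0 n (by omega) (fun m h1 h2 => (hpd0 m).trans (hlow m h1 h2))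
    have hm : ∀ᶠ x : ℝ in nhds 0, u x 0 ≤ u 0 0 := by
      have hc : Tendsto (fun x : ℝ => (x, (0 : ℝ))) (nhds 0) (nhds (0, 0)) :=
        (by fun_prop : Continuous fun x : ℝ => (x, (0 : ℝ))).tendsto' 0 _ rfl
      exact hc.eventually hmax
    have := odd_coeff (fun t => u t 0) η _ n hnodd hη he hm
    rw [hpd0, div_eq_zero_iff] at this
    exact this.resolve_right (by positivity)
  obtain ⟨η, hη, heη⟩ := peano _ hg0 l (by omega) (fun m h1 h2 => by
    rw [hpd0]
    rcases lt_trichotomy m n with h | rfl | h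
    · exact hlow m h1 h
    · exact hn0
    · exact hlmin m h h2)
  obtain ⟨ζ, hζ, heζ⟩ := peano _ hg1 (n - 1) (by omega) (fun m h1 h2 => by
    rw [hpd1]
    rcases (by omega : m = 1 ∨ 2 ≤ m) with rfl | h
    · exact hxy
    · have := hnmin (m + 1) (by omega) (by omega) 1 (by omega)
      simpa using this)
  obtain ⟨ε, hε, heε⟩ := y_taylor u hu
  rw [hpd0] at heη
  rw [hpd1] at heζ
  obtain ⟨N, rfl⟩ : ∃ N, n = N + 3 := ⟨n - 3, by omega⟩
  obtain ⟨L, rfl⟩ : ∃ L, l = L + 3 := ⟨l - 3, by omega⟩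
  obtain ⟨_, Q, _, hQ, _, hQ0, hI⟩ := z_expand N
  obtain ⟨P, _, hP, _, hP0, _, hR⟩ := z_expand L
  have hQt : Tendsto Q (nhds 0) (nhds 0) := hQ.tendsto' _ _ hQ0
  have hPt : Tendsto P (nhds 0) (nhds 0) := hP.tendsto' _ _ hP0
  have hfst : Tendsto (Prod.fst : ℝ × ℝ → ℝ) (nhds 0) (nhds 0) := continuous_fst.tendsto' _ _ rfl
  have hη' := hη.comp hfst
  have hζ' := hζ.comp hfst
  simp only [show N + 3 - 1 = N + 2 by omega] at heζ ⊢
  set a := pd u (N + 2) 1 0 0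
  set b := pd u (L + 3) 0 0 0
  have hζ2 : Tendsto (fun p : ℝ × ℝ => ζ p.1 / ((N : ℝ) + 3)) (nhds 0) (nhds 0) := by
    simpa using hζ'.div_const ((N : ℝ) + 3)
  refine ⟨fun p => ε p - (a / ((N + 3).factorial : ℝ) + ζ p.1 / ((N : ℝ) + 3)) * Q p
      - (b / ((L + 3).factorial : ℝ) + η p.1) * P p,
    fun p => ζ p.1 / ((N : ℝ) + 3), fun p => η p.1, ?_, hζ2, hη', ?_⟩
  · have h1 := (hζ2.const_add (a / ((N + 3).factorial : ℝ))).mul hQt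
    have h2 := (hη'.const_add (b / ((L + 3).factorial : ℝ))).mul hPt
    simpa using (hε.sub h1).sub h2
  · refine Eventually.of_forall ?_
    rintro ⟨x, y⟩
    have hpd2 : pd u 0 2 0 0 = pdy (pdy u) 0 0 := rfl
    have hfac : ((N + 3).factorial : ℝ) = ((N : ℝ) + 3) * ((N + 2).factorial : ℝ) := by
      rw [Nat.factorial_succ]; push_cast; ring
    have h1 := heε x y
    have h2 := heη x
    have h3 := heζ x
    have h4 : pdy u 0 0 = 0 := hcy
    simp only [(hI x y).2, (hR x y).1, hpd2]
    rw [h1, h2, h3, h4, hfac]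
    have hN3 : (N : ℝ) + 3 ≠ 0 := by positivity
    have hF : ((N + 2).factorial : ℝ) ≠ 0 := by positivity
    have hF' : ((L + 3).factorial : ℝ) ≠ 0 := by positivity
    field_simp
    ring
end

section
/- Let u be a solution of -Δu = f(u) in B₁ and let n ≥ 3 be an integer. Suppose that all partial derivatives of u of every order m with 1 ≤ m ≤ n-1 vanish at (0,0), and that some partial derivative of u of order n is nonzero at (0,0). Then (0,0) is an isolated critical point of u: there exists δ > 0 such that ∇u(x,y) ≠ (0,0) for all (x,y) with 0 < x² + y² < δ². -/
open Filter Metric Set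

open scoped ContDiff

/-- smoothness on the ball for curried functions -/
def SmB (h : ℝ → ℝ → ℝ) : Prop := ContDiffOn ℝ (⊤ : ℕ∞) (fun p : ℝ × ℝ => h p.1 p.2) B1

/-- equality on the ball -/
def EqB (g h : ℝ → ℝ → ℝ) : Prop := ∀ x y : ℝ, (x, y) ∈ B1 → g x y = h x y

lemma isOpen_B1 : IsOpen B1 := Metric.isOpen_ball

lemma zero_mem_B1 : ((0 : ℝ), (0 : ℝ)) ∈ B1 := by
  have : (0 : ℝ × ℝ) ∈ B1 := Metric.mem_ball_self one_pos
  exact this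

lemma EqB.symm {g h : ℝ → ℝ → ℝ} (e : EqB g h) : EqB h g := fun x y p => (e x y p).symm
lemma EqB.trans {g h k : ℝ → ℝ → ℝ} (e : EqB g h) (e' : EqB h k) : EqB g k :=
  fun x y p => (e x y p).trans (e' x y p)

lemma EqB.pdx {g h : ℝ → ℝ → ℝ} (e : EqB g h) : EqB (pdx g) (pdx h) := by
  intro x y hp
  apply Filter.EventuallyEq.deriv_eq
  have hc : Continuous fun t : ℝ => (t, y) := by fun_prop
  filter_upwards [hc.continuousAt.preimage_mem_nhds (isOpen_B1.mem_nhds hp)] with t ht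
  exact e t y ht

lemma EqB.pdy {g h : ℝ → ℝ → ℝ} (e : EqB g h) : EqB (pdy g) (pdy h) := by
  intro x y hp
  apply Filter.EventuallyEq.deriv_eq
  have hc : Continuous fun t : ℝ => (x, t) := by fun_prop
  filter_upwards [hc.continuousAt.preimage_mem_nhds (isOpen_B1.mem_nhds hp)] with t ht
  exact e x t ht

lemma EqB.pdxi {g h : ℝ → ℝ → ℝ} (e : EqB g h) (i : ℕ) :
    EqB (_root_.pdx^[i] g) (_root_.pdx^[i] h) := by
  induction i generalizing g h with
  | zero => exact e
  | succ i ih => exact ih e.pdx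

lemma EqB.pdyi {g h : ℝ → ℝ → ℝ} (e : EqB g h) (i : ℕ) :
    EqB (_root_.pdy^[i] g) (_root_.pdy^[i] h) := by
  induction i generalizing g h with
  | zero => exact e
  | succ i ih => exact ih e.pdy

lemma EqB.pd {g h : ℝ → ℝ → ℝ} (e : EqB g h) (i j : ℕ) :
    EqB (_root_.pd g i j) (_root_.pd h i j) := (e.pdyi j).pdxi i

lemma SmB.congr {g h : ℝ → ℝ → ℝ} (s : SmB g) (e : EqB g h) : SmB h :=
  ContDiffOn.congr s (fun p hp => (e p.1 p.2 hp).symm)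

lemma SmB.cda {h : ℝ → ℝ → ℝ} (s : SmB h) {p : ℝ × ℝ} (hp : p ∈ B1) :
    ContDiffAt ℝ (⊤ : ℕ∞) (fun p : ℝ × ℝ => h p.1 p.2) p :=
  ContDiffOn.contDiffAt s (isOpen_B1.mem_nhds hp)

lemma SmB.da {h : ℝ → ℝ → ℝ} (s : SmB h) {p : ℝ × ℝ} (hp : p ∈ B1) :
    DifferentiableAt ℝ (fun p : ℝ × ℝ => h p.1 p.2) p :=
  (s.cda hp).differentiableAt (by simp)

lemma SmB.hasX {h : ℝ → ℝ → ℝ} (s : SmB h) {x y : ℝ} (hp : (x, y) ∈ B1) :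
    HasDerivAt (fun t => h t y) (fderiv ℝ (fun p : ℝ × ℝ => h p.1 p.2) (x, y) (1, 0)) x := by
  have h1 : HasDerivAt (fun t : ℝ => (t, y)) ((1 : ℝ), (0 : ℝ)) x :=
    (hasDerivAt_id x).prodMk (hasDerivAt_const x y)
  exact (s.da hp).hasFDerivAt.comp_hasDerivAt x h1

lemma SmB.hasY {h : ℝ → ℝ → ℝ} (s : SmB h) {x y : ℝ} (hp : (x, y) ∈ B1) :
    HasDerivAt (fun t => h x t) (fderiv ℝ (fun p : ℝ × ℝ => h p.1 p.2) (x, y) (0, 1)) y := by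
  have h1 : HasDerivAt (fun t : ℝ => (x, t)) ((0 : ℝ), (1 : ℝ)) y :=
    (hasDerivAt_const y x).prodMk (hasDerivAt_id y)
  exact (s.da hp).hasFDerivAt.comp_hasDerivAt y h1

lemma SmB.pdx_eq {h : ℝ → ℝ → ℝ} (s : SmB h) {x y : ℝ} (hp : (x, y) ∈ B1) :
    pdx h x y = fderiv ℝ (fun p : ℝ × ℝ => h p.1 p.2) (x, y) (1, 0) := (s.hasX hp).deriv

lemma SmB.pdy_eq {h : ℝ → ℝ → ℝ} (s : SmB h) {x y : ℝ} (hp : (x, y) ∈ B1) :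
    pdy h x y = fderiv ℝ (fun p : ℝ × ℝ => h p.1 p.2) (x, y) (0, 1) := (s.hasY hp).deriv

lemma SmB.fd {h : ℝ → ℝ → ℝ} (s : SmB h) :
    ContDiffOn ℝ (⊤ : ℕ∞) (fderiv ℝ (fun p : ℝ × ℝ => h p.1 p.2)) B1 :=
  ContDiffOn.fderiv_of_isOpen s isOpen_B1 (by simp)

lemma SmB.pdx {h : ℝ → ℝ → ℝ} (s : SmB h) : SmB (pdx h) := by
  have := s.fd.clm_apply (contDiffOn_const (c := ((1 : ℝ), (0 : ℝ))))
  exact ContDiffOn.congr this (fun p hp => s.pdx_eq hp)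

lemma SmB.pdy {h : ℝ → ℝ → ℝ} (s : SmB h) : SmB (pdy h) := by
  have := s.fd.clm_apply (contDiffOn_const (c := ((0 : ℝ), (1 : ℝ))))
  exact ContDiffOn.congr this (fun p hp => s.pdy_eq hp)

lemma SmB.comm {h : ℝ → ℝ → ℝ} (s : SmB h) :
    EqB (_root_.pdx (_root_.pdy h)) (_root_.pdy (_root_.pdx h)) := by
  intro x y hp
  have hsym : IsSymmSndFDerivAt ℝ (fun p : ℝ × ℝ => h p.1 p.2) (x, y) :=
    (s.cda hp).isSymmSndFDerivAt (by
      rw [minSmoothness_of_isRCLikeNormedField]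
      exact WithTop.coe_le_coe.2 (le_top : (2 : ℕ∞) ≤ ⊤))
  have hd : DifferentiableAt ℝ (fderiv ℝ (fun p : ℝ × ℝ => h p.1 p.2)) (x, y) :=
    (s.fd.contDiffAt (isOpen_B1.mem_nhds hp)).differentiableAt (by simp)
  have hx : HasDerivAt (fun t : ℝ => (t, y)) ((1 : ℝ), (0 : ℝ)) x :=
    (hasDerivAt_id x).prodMk (hasDerivAt_const x y)
  have hy : HasDerivAt (fun t : ℝ => (x, t)) ((0 : ℝ), (1 : ℝ)) y :=
    (hasDerivAt_const y x).prodMk (hasDerivAt_id y)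
  have e1 : _root_.pdx (_root_.pdy h) x y =
      _root_.pdx (fun a b => fderiv ℝ (fun p : ℝ × ℝ => h p.1 p.2) (a, b) (0, 1)) x y :=
    EqB.pdx (fun a b hab => s.pdy_eq hab) x y hp
  have e2 : _root_.pdy (_root_.pdx h) x y =
      _root_.pdy (fun a b => fderiv ℝ (fun p : ℝ × ℝ => h p.1 p.2) (a, b) (1, 0)) x y :=
    EqB.pdy (fun a b hab => s.pdx_eq hab) x y hp
  have c1 : HasDerivAt (fun t : ℝ => fderiv ℝ (fun p : ℝ × ℝ => h p.1 p.2) (t, y))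
      (fderiv ℝ (fderiv ℝ (fun p : ℝ × ℝ => h p.1 p.2)) (x, y) (1, 0)) x :=
    HasFDerivAt.comp_hasDerivAt x hd.hasFDerivAt hx
  have c2 : HasDerivAt (fun t : ℝ => fderiv ℝ (fun p : ℝ × ℝ => h p.1 p.2) (x, t))
      (fderiv ℝ (fderiv ℝ (fun p : ℝ × ℝ => h p.1 p.2)) (x, y) (0, 1)) y :=
    HasFDerivAt.comp_hasDerivAt y hd.hasFDerivAt hy
  have d1 := c1.clm_apply (hasDerivAt_const x ((0 : ℝ), (1 : ℝ)))
  have d2 := c2.clm_apply (hasDerivAt_const y ((1 : ℝ), (0 : ℝ)))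
  rw [e1, e2]
  unfold _root_.pdx _root_.pdy
  rw [d1.deriv, d2.deriv, map_zero, add_zero, add_zero]
  exact hsym.eq (1, 0) (0, 1)

lemma SmB.pdyi {h : ℝ → ℝ → ℝ} (s : SmB h) (j : ℕ) : SmB (_root_.pdy^[j] h) := by
  induction j generalizing h with
  | zero => exact s
  | succ j ih => exact ih s.pdy

lemma SmB.pdxi {h : ℝ → ℝ → ℝ} (s : SmB h) (j : ℕ) : SmB (_root_.pdx^[j] h) := by
  induction j generalizing h with
  | zero => exact s
  | succ j ih => exact ih s.pdx

lemma SmB.commi {h : ℝ → ℝ → ℝ} (s : SmB h) (j : ℕ) :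
    EqB (_root_.pdy^[j] (_root_.pdx h)) (_root_.pdx (_root_.pdy^[j] h)) := by
  induction j generalizing h with
  | zero => exact fun _ _ _ => rfl
  | succ j ih =>
    exact (EqB.pdyi s.comm.symm j).trans (ih s.pdy)

lemma pd_pdy (h : ℝ → ℝ → ℝ) (i j : ℕ) : pd (pdy h) i j = pd h i (j + 1) := rfl

lemma SmB.pd_pdx {h : ℝ → ℝ → ℝ} (s : SmB h) (i j : ℕ) :
    EqB (pd (_root_.pdx h) i j) (pd h (i + 1) j) := (s.commi j).pdxi i

lemma SmB.add {g h : ℝ → ℝ → ℝ} (s : SmB g) (t : SmB h) : SmB (fun x y => g x y + h x y) :=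
  ContDiffOn.add s t
lemma SmB.sub {g h : ℝ → ℝ → ℝ} (s : SmB g) (t : SmB h) : SmB (fun x y => g x y - h x y) :=
  ContDiffOn.sub s t
lemma SmB.mul {g h : ℝ → ℝ → ℝ} (s : SmB g) (t : SmB h) : SmB (fun x y => g x y * h x y) :=
  ContDiffOn.mul s t
lemma SmB.comp {f : ℝ → ℝ} {h : ℝ → ℝ → ℝ} (hf : ContDiff ℝ (⊤ : ℕ∞) f) (t : SmB h) :
    SmB (fun x y => f (h x y)) :=
  hf.comp_contDiffOn t

lemma pd_add {g h : ℝ → ℝ → ℝ} (s : SmB g) (t : SmB h) (i j : ℕ) :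
    EqB (pd (fun x y => g x y + h x y) i j) (fun x y => pd g i j x y + pd h i j x y) := by
  have hy : EqB (pdy^[j] (fun x y => g x y + h x y))
      (fun x y => (pdy^[j] g) x y + (pdy^[j] h) x y) := by
    induction j generalizing g h with
    | zero => exact fun _ _ _ => rfl
    | succ j ih =>
      exact EqB.trans (EqB.pdyi (fun x y hp =>
        ((s.hasY hp).differentiableAt.hasDerivAt.add
          (t.hasY hp).differentiableAt.hasDerivAt).deriv) j) (ih s.pdy t.pdy)
  have hx : ∀ {g h : ℝ → ℝ → ℝ} (_ : SmB g) (_ : SmB h), EqB (pdx^[i] (fun x y => g x y + h x y))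
      (fun x y => (pdx^[i] g) x y + (pdx^[i] h) x y) := by
    clear hy s t
    induction i with
    | zero => exact fun _ _ _ _ _ => rfl
    | succ i ih =>
      intro g h s t
      exact EqB.trans (EqB.pdxi (fun x y hp =>
        ((s.hasX hp).differentiableAt.hasDerivAt.add
          (t.hasX hp).differentiableAt.hasDerivAt).deriv) i) (ih s.pdx t.pdx)
  exact (hy.pdxi i).trans (hx (s.pdyi j) (t.pdyi j))

lemma pd_add0 {g h : ℝ → ℝ → ℝ} (s : SmB g) (t : SmB h) (i j : ℕ) :
    pd (fun x y => g x y + h x y) i j 0 0 = pd g i j 0 0 + pd h i j 0 0 :=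
  pd_add s t i j 0 0 zero_mem_B1

/-- all derivatives of order at most `m` vanish at the origin -/
def FlatO (m : ℕ) (h : ℝ → ℝ → ℝ) : Prop := ∀ i j, i + j ≤ m → pd h i j 0 0 = 0

lemma FlatO.congr {m : ℕ} {g h : ℝ → ℝ → ℝ} (k : FlatO m g) (e : EqB g h) : FlatO m h :=
  fun i j hij => (e.pd i j 0 0 zero_mem_B1).symm.trans (k i j hij)

lemma FlatO.mono {m m' : ℕ} {g : ℝ → ℝ → ℝ} (k : FlatO m g) (e : m' ≤ m) : FlatO m' g :=
  fun i j hij => k i j (hij.trans e)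

lemma FlatO.pdy {m : ℕ} {h : ℝ → ℝ → ℝ} (k : FlatO (m + 1) h) : FlatO m (pdy h) :=
  fun i j hij => k i (j + 1) (by omega)

lemma FlatO.pdx {m : ℕ} {h : ℝ → ℝ → ℝ} (s : SmB h) (k : FlatO (m + 1) h) : FlatO m (pdx h) :=
  fun i j hij => (s.pd_pdx i j 0 0 zero_mem_B1).trans (k (i + 1) j (by omega))

lemma FlatO.of_grad {m : ℕ} {h : ℝ → ℝ → ℝ} (s : SmB h) (h0 : h 0 0 = 0)
    (kx : FlatO m (_root_.pdx h)) (ky : FlatO m (_root_.pdy h)) : FlatO (m + 1) h := by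
  intro i j hij
  rcases j with _ | j
  · rcases i with _ | i
    · exact h0
    · exact kx i 0 (by omega)
  · exact ky i j (by omega)

lemma FlatO.add {m : ℕ} {g h : ℝ → ℝ → ℝ} (s : SmB g) (t : SmB h) (k : FlatO m g)
    (l : FlatO m h) : FlatO m (fun x y => g x y + h x y) := by
  intro i j hij
  rw [pd_add0 s t i j, k i j hij, l i j hij, add_zero]

lemma FlatO.mul {m : ℕ} {g h : ℝ → ℝ → ℝ} (s : SmB g) (t : SmB h) (l : FlatO m h) :
    FlatO m (fun x y => g x y * h x y) := by
  induction m generalizing g h with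
  | zero =>
    intro i j hij
    obtain ⟨rfl, rfl⟩ : i = 0 ∧ j = 0 := by omega
    have : h 0 0 = 0 := l 0 0 le_rfl
    change g 0 0 * h 0 0 = 0
    rw [this, mul_zero]
  | succ m ih =>
    have : h 0 0 = 0 := l 0 0 (by omega)
    refine FlatO.of_grad (s.mul t) (by simp [this]) ?_ ?_
    · refine (FlatO.add (s.pdx.mul t) (s.mul t.pdx) (ih s.pdx t (l.mono (by omega)))
        (ih s t.pdx (FlatO.pdx t l))).congr ?_
      intro x y hp
      exact ((s.hasX hp).differentiableAt.hasDerivAt.mul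
          (t.hasX hp).differentiableAt.hasDerivAt).deriv.symm
    · refine (FlatO.add (s.pdy.mul t) (s.mul t.pdy) (ih s.pdy t (l.mono (by omega)))
        (ih s t.pdy (FlatO.pdy l))).congr ?_
      intro x y hp
      exact ((s.hasY hp).differentiableAt.hasDerivAt.mul
          (t.hasY hp).differentiableAt.hasDerivAt).deriv.symm

lemma FlatO.comp {m : ℕ} {f : ℝ → ℝ} {h : ℝ → ℝ → ℝ} (hf : ContDiff ℝ (⊤ : ℕ∞) f) (t : SmB h)
    (h0 : f (h 0 0) = 0) (kx : FlatO m (_root_.pdx h)) (ky : FlatO m (_root_.pdy h)) :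
    FlatO (m + 1) (fun x y => f (h x y)) := by
  have hd : ContDiff ℝ (⊤ : ℕ∞) (deriv f) := by
    have := (contDiff_infty_iff_deriv (𝕜 := ℝ) (f := f)).1 hf
    exact this.2
  have hfd : ∀ z, HasDerivAt f (deriv f z) z := fun z =>
    (hf.differentiable (by simp) z).hasDerivAt
  refine FlatO.of_grad (SmB.comp hf t) h0 ?_ ?_
  · refine (FlatO.mul (SmB.comp hd t) t.pdx kx).congr ?_
    intro x y hp
    exact ((hfd _).comp x (t.hasX hp).differentiableAt.hasDerivAt).deriv.symm
  · refine (FlatO.mul (SmB.comp hd t) t.pdy ky).congr ?_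
    intro x y hp
    exact ((hfd _).comp y (t.hasY hp).differentiableAt.hasDerivAt).deriv.symm

lemma FlatO.small {m : ℕ} {h : ℝ → ℝ → ℝ} (s : SmB h) (k : FlatO m h) :
    ∀ ε > 0, ∃ δ > 0, ∀ p : ℝ × ℝ, ‖p‖ < δ → |h p.1 p.2| ≤ ε * ‖p‖ ^ m := by
  induction m generalizing h with
  | zero =>
    intro ε hε
    have hc := (s.da zero_mem_B1).continuousAt
    obtain ⟨δ, hδ, H⟩ := Metric.continuousAt_iff.1 hc ε hε
    refine ⟨δ, hδ, fun p hp => ?_⟩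
    have h0 : h 0 0 = 0 := k 0 0 le_rfl
    have := @H p (by rw [show (((0 : ℝ), (0 : ℝ)) : ℝ × ℝ) = 0 from rfl, dist_zero_right]; exact hp)
    simp only [h0, Real.dist_eq, sub_zero] at this
    simpa using this.le
  | succ m ih =>
    intro ε hε
    obtain ⟨δ₁, hδ₁, H₁⟩ := ih s.pdx (FlatO.pdx s k) (ε / 2) (by positivity)
    obtain ⟨δ₂, hδ₂, H₂⟩ := ih s.pdy (FlatO.pdy k) (ε / 2) (by positivity)
    refine ⟨min 1 (min δ₁ δ₂), by positivity, fun p hp => ?_⟩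
    have hp1 : ‖p‖ < 1 := hp.trans_le (min_le_left _ _)
    have hp2 : ‖p‖ < δ₁ := hp.trans_le ((min_le_right _ _).trans (min_le_left _ _))
    have hp3 : ‖p‖ < δ₂ := hp.trans_le ((min_le_right _ _).trans (min_le_right _ _))
    have hB : ∀ q ∈ Metric.closedBall (0 : ℝ × ℝ) ‖p‖, q ∈ B1 := by
      intro q hq
      rw [mem_closedBall_zero_iff] at hq
      exact mem_ball_zero_iff.2 (hq.trans_lt hp1)
    have key := (convex_closedBall (0 : ℝ × ℝ) ‖p‖).norm_image_sub_le_of_norm_fderiv_le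
      (𝕜 := ℝ) (f := fun p : ℝ × ℝ => h p.1 p.2) (C := ε * ‖p‖ ^ m) (x := 0) (y := p)
      (fun q hq => s.da (hB q hq)) ?_ (by simp) (by simp)
    · have h0 : h 0 0 = 0 := k 0 0 (by omega)
      simp only [Prod.fst_zero, Prod.snd_zero, h0, sub_zero, Real.norm_eq_abs] at key
      rw [pow_succ, ← mul_assoc]; exact key
    · intro q hq
      have hqB := hB q hq
      rw [mem_closedBall_zero_iff] at hq
      have a1 := H₁ q (hq.trans_lt hp2)
      have a2 := H₂ q (hq.trans_lt hp3)
      rw [s.pdx_eq hqB] at a1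
      rw [s.pdy_eq hqB] at a2
      have hqm : ‖q‖ ^ m ≤ ‖p‖ ^ m := by gcongr
      refine ContinuousLinearMap.opNorm_le_bound _ (by positivity) (fun v => ?_)
      have hv : v = v.1 • ((1 : ℝ), (0 : ℝ)) + v.2 • ((0 : ℝ), (1 : ℝ)) := by ext <;> simp
      conv_lhs => rw [hv, map_add, map_smul, map_smul]
      have v1 : |v.1| ≤ ‖v‖ := norm_fst_le v
      have v2 : |v.2| ≤ ‖v‖ := norm_snd_le v
      have b1 : |fderiv ℝ (fun p : ℝ × ℝ => h p.1 p.2) q (1, 0)| ≤ ε / 2 * ‖p‖ ^ m :=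
        a1.trans (by gcongr)
      have b2 : |fderiv ℝ (fun p : ℝ × ℝ => h p.1 p.2) q (0, 1)| ≤ ε / 2 * ‖p‖ ^ m :=
        a2.trans (by gcongr)
      refine (norm_add_le _ _).trans ?_
      rw [norm_smul, norm_smul]
      simp only [Real.norm_eq_abs]
      have c1 := mul_le_mul v1 b1 (abs_nonneg _) (norm_nonneg v)
      have c2 := mul_le_mul v2 b2 (abs_nonneg _) (norm_nonneg v)
      linarith

/-- real part of `c z^m` -/
noncomputable def RP (c : ℂ) (m : ℕ) : ℝ → ℝ → ℝ :=
  fun x y => (c * ((x : ℂ) + (y : ℂ) * Complex.I) ^ m).re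

lemma RP_smooth (c : ℂ) (m : ℕ) : SmB (RP c m) := by
  apply ContDiff.contDiffOn
  unfold RP
  have h1 : ContDiff ℝ (⊤ : ℕ∞) (fun p : ℝ × ℝ => (p.1 : ℂ)) :=
    Complex.ofRealCLM.contDiff.comp contDiff_fst
  have h2 : ContDiff ℝ (⊤ : ℕ∞) (fun p : ℝ × ℝ => (p.2 : ℂ)) :=
    Complex.ofRealCLM.contDiff.comp contDiff_snd
  exact Complex.reCLM.contDiff.comp
    (contDiff_const.mul ((h1.add (h2.mul contDiff_const)).pow m))

lemma RP_pdx (c : ℂ) (m : ℕ) : pdx (RP c m) = RP (c * m) (m - 1) := by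
  funext x y
  have h1 : HasDerivAt (fun t : ℝ => (t : ℂ) + (y : ℂ) * Complex.I) 1 x :=
    (Complex.ofRealCLM.hasDerivAt (x := x)).add_const _
  have h2 := (h1.pow m).const_mul c
  have h3 := (Complex.reCLM.hasFDerivAt).comp_hasDerivAt x h2
  refine h3.deriv.trans ?_
  simp only [RP, Complex.reCLM_apply]
  congr 1; ring

lemma RP_pdy (c : ℂ) (m : ℕ) : pdy (RP c m) = RP (c * m * Complex.I) (m - 1) := by
  funext x y
  have h1 : HasDerivAt (fun t : ℝ => (x : ℂ) + (t : ℂ) * Complex.I) (1 * Complex.I) y :=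
    ((Complex.ofRealCLM.hasDerivAt (x := y)).mul_const _).const_add _
  have h2 := (h1.pow m).const_mul c
  have h3 := (Complex.reCLM.hasFDerivAt).comp_hasDerivAt y h2
  refine h3.deriv.trans ?_
  simp only [RP, Complex.reCLM_apply]
  congr 1; ring

lemma RP_pdyi (c : ℂ) (m j : ℕ) :
    pdy^[j] (RP c m) = RP (c * (m.descFactorial j : ℕ) * Complex.I ^ j) (m - j) := by
  induction j with
  | zero => simp
  | succ j ih =>
    rw [Function.iterate_succ_apply', ih, RP_pdy, Nat.descFactorial_succ, Nat.sub_sub]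
    congr 1; push_cast; ring

lemma RP_pdxi (c : ℂ) (m j : ℕ) :
    pdx^[j] (RP c m) = RP (c * (m.descFactorial j : ℕ)) (m - j) := by
  induction j with
  | zero => simp
  | succ j ih =>
    rw [Function.iterate_succ_apply', ih, RP_pdx, Nat.descFactorial_succ, Nat.sub_sub]
    congr 1; push_cast; ring

lemma RP_pd (c : ℂ) (m i j : ℕ) :
    pd (RP c m) i j = RP (c * (m.descFactorial j : ℕ) * Complex.I ^ j *
      ((m - j).descFactorial i : ℕ)) (m - j - i) := by
  rw [pd, RP_pdyi, RP_pdxi]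

lemma RP_zero (c : ℂ) {m : ℕ} (hm : m ≠ 0) : RP c m 0 0 = 0 := by simp [RP, hm]

lemma RP_const_zero (c : ℂ) : RP c 0 0 0 = c.re := by simp [RP]

/-- if all partial derivatives of `u` of orders `1,…,n-1` vanish at the
origin and some derivative of order `n ≥ 3` does not, then the origin is an isolated
critical point of the solution `u`. -/
theorem isolated_critical_point
    (u : ℝ → ℝ → ℝ) (f : ℝ → ℝ)
    (hu : ContDiffOn ℝ (⊤ : ℕ∞) (fun p : ℝ × ℝ => u p.1 p.2) B1)
    (hf : ContDiff ℝ (⊤ : ℕ∞) f)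
    (hpde : ∀ x y : ℝ, (x, y) ∈ B1 → -(pd u 2 0 x y + pd u 0 2 x y) = f (u x y))
    (n : ℕ) (hn3 : 3 ≤ n)
    (hvan : ∀ m k : ℕ, 1 ≤ m → m ≤ n - 1 → k ≤ m → pd u (m - k) k 0 0 = 0)
    (hne : ∃ k : ℕ, k ≤ n ∧ pd u (n - k) k 0 0 ≠ 0) :
    ∃ δ : ℝ, 0 < δ ∧ ∀ x y : ℝ, 0 < x ^ 2 + y ^ 2 → x ^ 2 + y ^ 2 < δ ^ 2 →
      ¬ (pd u 1 0 x y = 0 ∧ pd u 0 1 x y = 0) := by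
  have su : SmB u := hu
  have hv : ∀ i j : ℕ, 1 ≤ i + j → i + j ≤ n - 1 → pd u i j 0 0 = 0 := by
    intro i j h1 h2
    have := hvan (i + j) j h1 h2 (by omega)
    rwa [Nat.add_sub_cancel] at this
  obtain ⟨N, rfl⟩ : ∃ N, n = N + 3 := ⟨n - 3, by omega⟩
  have kx : FlatO (N + 1) (pdx u) := fun i j hij =>
    (su.pd_pdx i j 0 0 zero_mem_B1).trans (hv _ _ (by omega) (by omega))
  have ky : FlatO (N + 1) (pdy u) := fun i j hij => hv i (j + 1) (by omega) (by omega)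
  have f0 : f (u 0 0) = 0 := by
    rw [← hpde 0 0 zero_mem_B1, hv 2 0 (by omega) (by omega), hv 0 2 (by omega) (by omega)]
    simp
  have kf : FlatO (N + 2) (fun x y => f (u x y)) := FlatO.comp hf su f0 kx ky
  have kD : FlatO (N + 2) (fun x y => pdx (pdx u) x y + pdy (pdy u) x y) := by
    have hm1 : SmB (fun _ _ => (-1 : ℝ)) := contDiffOn_const
    refine (FlatO.mul hm1 (SmB.comp hf su) kf).congr ?_
    intro x y hp
    have e := hpde x y hp
    change -1 * f (u x y) = pd u 2 0 x y + pd u 0 2 x y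
    linarith
  -- relation among derivatives of order n
  have rel : ∀ i j : ℕ, i + j = N + 1 → pd u i (j + 2) 0 0 = - pd u (i + 2) j 0 0 := by
    intro i j hij
    have h1 := kD i j (by omega)
    rw [pd_add0 su.pdx.pdx su.pdy.pdy i j, su.pdx.pd_pdx i j 0 0 zero_mem_B1,
      su.pd_pdx (i + 1) j 0 0 zero_mem_B1] at h1
    change pd u (i + 2) j 0 0 + pd u i (j + 2) 0 0 = 0 at h1
    linarith
  set a := pd u (N + 3) 0 0 0 with ha
  set b := pd u (N + 2) 1 0 0 with hb
  set d : ℂ := (a : ℂ) - b * Complex.I with hd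
  have top : ∀ j i : ℕ, i + j = N + 3 → pd u i j 0 0 = (d * Complex.I ^ j).re := by
    intro j
    induction j using Nat.strong_induction_on with
    | _ j ih =>
      intro i hij
      match j, ih, hij with
      | 0, _, hij =>
        obtain rfl : i = N + 3 := by omega
        simp [hd, ← ha]
      | 1, _, hij =>
        obtain rfl : i = N + 2 := by omega
        simp [hd, ← hb]
      | j + 2, ih, hij =>
        rw [rel i j (by omega), ih j (by omega) (i + 2) (by omega), pow_add, Complex.I_sq]
        simp
  have dne : d ≠ 0 := by
    intro h0
    obtain ⟨k, hk, hne⟩ := hne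
    apply hne
    rw [top k (N + 3 - k) (by omega), h0]; simp
  set F : ℂ := (((N + 3).factorial : ℕ) : ℂ) with hF
  have Fne : F ≠ 0 := by simp [hF, Nat.factorial_ne_zero]
  set c : ℂ := - (d / F) with hc
  have cne : c ≠ 0 := neg_ne_zero.2 (div_ne_zero dne Fne)
  set h : ℝ → ℝ → ℝ := fun x y => u x y + RP c (N + 3) x y with hh
  have sP := RP_smooth c (N + 3)
  have sh : SmB h := su.add sP
  have hpd : ∀ i j : ℕ, 1 ≤ i + j → i + j ≤ N + 3 → pd h i j 0 0 = 0 := by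
    intro i j h1 h2
    rw [hh, pd_add0 su sP i j, RP_pd]
    rcases Nat.lt_or_ge (i + j) (N + 3) with h3 | h3
    · rw [hv i j h1 (by omega), RP_zero _ (by omega), add_zero]
    · have h4 : i + j = N + 3 := by omega
      rw [top j i h4, show N + 3 - j - i = 0 by omega, RP_const_zero, show N + 3 - j = i by omega,
        Nat.descFactorial_self, ← Complex.add_re]
      have hfac : (((N + 3).descFactorial j : ℕ) : ℂ) * ((i.factorial : ℕ) : ℂ) = F := by
        rw [hF, ← Nat.cast_mul, mul_comm]
        congr 1
        have := Nat.factorial_mul_descFactorial (n := N + 3) (k := j) (by omega)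
        rwa [show N + 3 - j = i by omega] at this
      have : d * Complex.I ^ j + c * (((N + 3).descFactorial j : ℕ) : ℂ) * Complex.I ^ j *
          ((i.factorial : ℕ) : ℂ) = 0 := by
        have e : c * F = - d := by rw [hc]; field_simp
        calc _ = d * Complex.I ^ j + (c * ((((N + 3).descFactorial j : ℕ) : ℂ) *
            ((i.factorial : ℕ) : ℂ))) * Complex.I ^ j := by ring
          _ = 0 := by rw [hfac, e]; ring
      rw [this]; simp
  have lx : FlatO (N + 2) (pdx h) := fun i j hij =>
    (sh.pd_pdx i j 0 0 zero_mem_B1).trans (hpd _ _ (by omega) (by omega))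
  have ly : FlatO (N + 2) (pdy h) := fun i j hij => hpd i (j + 1) (by omega) (by omega)
  set w : ℂ := c * ((N + 3 : ℕ) : ℂ) with hw
  have wne : w ≠ 0 := mul_ne_zero cne (by exact_mod_cast (by omega : N + 3 ≠ 0))
  have wpos : 0 < ‖w‖ := norm_pos_iff.2 wne
  obtain ⟨δ₁, hδ₁, H₁⟩ := FlatO.small sh.pdx lx (‖w‖ / 3) (by positivity)
  obtain ⟨δ₂, hδ₂, H₂⟩ := FlatO.small sh.pdy ly (‖w‖ / 3) (by positivity)
  refine ⟨min 1 (min δ₁ δ₂), by positivity, fun x y hpos hlt hcrit => ?_⟩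
  obtain ⟨cx, cy⟩ := hcrit
  have hδ0 : 0 ≤ min 1 (min δ₁ δ₂) := by positivity
  set z : ℂ := (x : ℂ) + (y : ℂ) * Complex.I with hz
  have zre : z.re = x := by simp [hz]
  have zim : z.im = y := by simp [hz]
  have hx : |x| ≤ ‖z‖ := zre ▸ Complex.abs_re_le_norm z
  have hy : |y| ≤ ‖z‖ := zim ▸ Complex.abs_im_le_norm z
  have hzsq : ‖z‖ ^ 2 = x ^ 2 + y ^ 2 := by
    rw [Complex.sq_norm, Complex.normSq_apply, zre, zim]; ring
  have hzlt : ‖z‖ < min 1 (min δ₁ δ₂) := by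
    apply lt_of_pow_lt_pow_left₀ 2 hδ0
    rw [hzsq]; exact hlt
  have hzpos : 0 < ‖z‖ := by
    rcases (norm_nonneg z).eq_or_lt with h0 | h0
    · rw [← hzsq, ← h0] at hpos; norm_num at hpos
    · exact h0
  have hpz : ‖(x, y)‖ ≤ ‖z‖ := by
    rw [Prod.norm_def]; exact max_le hx hy
  have hp := hpz.trans_lt hzlt
  have hB : (x, y) ∈ B1 := mem_ball_zero_iff.2 (hp.trans_le (min_le_left _ _))
  have e1 := H₁ (x, y) (hp.trans_le ((min_le_right _ _).trans (min_le_left _ _)))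
  have e2 := H₂ (x, y) (hp.trans_le ((min_le_right _ _).trans (min_le_right _ _)))
  have g1 : pdx h x y = (w * z ^ (N + 2)).re := by
    have := pd_add su sP 1 0 x y hB
    change pdx h x y = pd u 1 0 x y + pdx (RP c (N + 3)) x y at this
    rw [this, cx, RP_pdx, zero_add]; rfl
  have g2 : pdy h x y = (w * Complex.I * z ^ (N + 2)).re := by
    have := pd_add su sP 0 1 x y hB
    change pdy h x y = pd u 0 1 x y + pdy (RP c (N + 3)) x y at this
    rw [this, cy, RP_pdy, zero_add]; rfl
  have gim : |pdy h x y| = |(w * z ^ (N + 2)).im| := by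
    rw [g2, show w * Complex.I * z ^ (N + 2) = w * z ^ (N + 2) * Complex.I by ring,
      Complex.mul_I_re, abs_neg]
  have hpw : ‖(x, y)‖ ^ (N + 2) ≤ ‖z‖ ^ (N + 2) := by gcongr
  have t := Complex.norm_le_abs_re_add_abs_im (w * z ^ (N + 2))
  rw [norm_mul, norm_pow] at t
  simp only [] at e1 e2
  rw [g1] at e1
  rw [gim] at e2
  have hpp : 0 < ‖z‖ ^ (N + 2) := by positivity
  have q : ‖w‖ / 3 * ‖(x, y)‖ ^ (N + 2) ≤ ‖w‖ / 3 * ‖z‖ ^ (N + 2) := by gcongr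
  have := mul_pos wpos hpp
  linarith
end
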